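/- Let T be a Y(2|1) T-family in A, let E be a right A-module with lowest weight covector Ω†, and let ū = (u₁,…,u_a), v̄ = (v₁,…,v_b) have admissible concatenation. Then the two explicit expressions for the dual Bethe vector agree: Σ g(v̄_I,ū_I)·f(ū_I,ū_II)·g(v̄_II,v̄_I)·h(ū_I,ū_I)·λ₂(v̄_I)·Ω†·𝕋₃₂(v̄_II)·T₂₁(ū_II)·𝕋₃₁(ū_I) = Σ K_ℓ(v̄_I|ū_I)·f(ū_I,ū_II)·g(v̄_II,v̄_I)·λ₂(ū_I)·Ω†·T₂₁(ū_II)·𝕋₃₂(v̄_II)·𝕋₃₁(v̄_I), where both sums run over all partitions ū = ū_I ⊔ ū_II, v̄ = v̄_I ⊔ v̄_II with #ū_I = #v̄_I = ℓ, h(ū_I,ū_I) = ∏_{u ≠ u′ ∈ ū_I} h(u,u′), and λ₂(w̄) = ∏ⱼ λ₂(wⱼ). -/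

import Mathlib

open scoped BigOperators
open MulOpposite

noncomputable section

namespace Bethe

variable {A : Type*} [Ring A] [Algebra ℂ A]

/-- `g(u,v) = c/(u-v)` -/
def gg (c u v : ℂ) : ℂ := c / (u - v)

/-- `f(u,v) = (u-v+c)/(u-v)` -/
def ff (c u v : ℂ) : ℂ := (u - v + c) / (u - v)

/-- `h(u,v) = (u-v+c)/c` -/
def hh (c u v : ℂ) : ℂ := (u - v + c) / c

/-- A list of parameters is admissible if its entries are pairwise distinct and
`x - y + c ≠ 0` for any two distinct entries `x`, `y`. -/
def Admissible (c : ℂ) (l : List ℂ) : Prop :=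
  l.Pairwise fun x y => x ≠ y ∧ x - y + c ≠ 0 ∧ y - x + c ≠ 0

/-- `∏_{x ∈ xs} ∏_{y ∈ ys} f(x,y)` -/
def prodFF (c : ℂ) (xs ys : List ℂ) : ℂ :=
  (xs.map fun x => (ys.map fun y => ff c x y).prod).prod

/-- `∏_{x ∈ xs} ∏_{y ∈ ys} g(x,y)` -/
def prodGG (c : ℂ) (xs ys : List ℂ) : ℂ :=
  (xs.map fun x => (ys.map fun y => gg c x y).prod).prod

/-- `∏_{x ∈ xs} ∏_{y ∈ ys} h(x,y)` -/
def prodHH (c : ℂ) (xs ys : List ℂ) : ℂ :=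
  (xs.map fun x => (ys.map fun y => hh c x y).prod).prod

/-- `H(w̄) = ∏_{j>k} h(wⱼ,wₖ)` -/
def Hnorm (c : ℂ) : List ℂ → ℂ
  | [] => 1
  | x :: xs => ((xs.map fun y => hh c y x).prod) * Hnorm c xs

/-- `H(w̄*) = ∏_{j<k} h(wⱼ,wₖ)` -/
def HnormRev (c : ℂ) : List ℂ → ℂ
  | [] => 1
  | x :: xs => ((xs.map fun y => hh c x y).prod) * HnormRev c xs

/-- product of `h` over ordered pairs of distinct positions of a list -/
def prodHHne (c : ℂ) (xs : List ℂ) : ℂ :=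
  ∏ j : Fin xs.length, ∏ k : Fin xs.length,
    if j ≠ k then hh c (xs.get j) (xs.get k) else 1

/-- ordered product `T(w₁)⋯T(wₙ)` -/
def Tprod (Tij : ℂ → A) (l : List ℂ) : A := (l.map Tij).prod

/-- normalized ordered product `H(w̄)⁻¹ T(w₁)⋯T(wₙ)` -/
def TT (c : ℂ) (Tij : ℂ → A) (l : List ℂ) : A := (Hnorm c l)⁻¹ • Tprod Tij l

/-- normalized ordered product `H(w̄*)⁻¹ T(w₁)⋯T(wₙ)` -/
def TTrev (c : ℂ) (Tij : ℂ → A) (l : List ℂ) : A := (HnormRev c l)⁻¹ • Tprod Tij l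

/-- The defining (RTT) commutation relations of a super-Yangian `T`-family with
`ℤ₂`-grading `p`. -/
def IsTFam (c : ℂ) {N : ℕ} (p : Fin N → ℕ) (T : Fin N → Fin N → ℂ → A) : Prop :=
  ∀ i j k l : Fin N, ∀ z w : ℂ, z ≠ w →
    T i j z * T k l w - ((-1 : ℂ) ^ ((p i + p j) * (p k + p l))) • (T k l w * T i j z)
      = ((-1 : ℂ) ^ (p l * (p i + p j) + p i * p j) * gg c z w) •
          (T i l z * T k j w - T i l w * T k j z)

/-- the distinguished grading of `gl(2|1)`: `[1]=[2]=0`, `[3]=1` -/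
def p21 : Fin 3 → ℕ := ![0, 0, 1]

/-- the distinguished grading of `gl(1|2)`: `[1]=0`, `[2]=[3]=1` -/
def p12 : Fin 3 → ℕ := ![0, 1, 1]

/-- the sublist of `l` given by the positions in `S`, in the inherited order -/
def sel (l : List ℂ) (S : Finset (Fin l.length)) : List ℂ :=
  (S.sort (· ≤ ·)).map l.get

/-- `λ(w̄) = ∏ⱼ λ(wⱼ)` -/
def lamP (lam2 : ℂ → ℂ) (l : List ℂ) : ℂ := (l.map lam2).prod

/-- The Izergin kernel `K_ℓ(v̄|ū)`. -/
def Kiz (c : ℂ) {ℓ : ℕ} (vs us : Fin ℓ → ℂ) : ℂ :=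
  (∏ j : Fin ℓ, ∏ k : Fin ℓ, if (k : ℕ) < (j : ℕ) then gg c (vs j) (vs k) else 1) *
    (∏ j : Fin ℓ, ∏ k : Fin ℓ, if (k : ℕ) < (j : ℕ) then gg c (us k) (us j) else 1) *
    (∏ j : Fin ℓ, ∏ k : Fin ℓ, hh c (vs j) (us k)) *
    Matrix.det (Matrix.of fun j k => gg c (vs j) (us k) / hh c (vs j) (us k))

/-- The Izergin kernel for lists of equal length (and junk value `0` otherwise). -/
def KizL (c : ℂ) (vs us : List ℂ) : ℂ :=
  if h : vs.length = us.length then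
    Kiz c vs.get fun j => us.get (Fin.cast h j)
  else 0

/-- The operator `X_{a,b}(ū,v̄)` of the paper (`Y(2|1)` case). -/
def X (c : ℂ) (T : Fin 3 → Fin 3 → ℂ → A) (u v : List ℂ) : A :=
  ∑ S : Finset (Fin u.length), ∑ Q : Finset (Fin v.length),
    if S.card = Q.card then
      (prodGG c (sel v Q) (sel u S) * prodFF c (sel u S) (sel u Sᶜ) *
          prodGG c (sel v Qᶜ) (sel v Q) * prodHHne c (sel u S)) •
        (TT c (T 0 2) (sel u S) * Tprod (T 0 1) (sel u Sᶜ) *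
          TT c (T 1 2) (sel v Qᶜ) * Tprod (T 1 1) (sel v Q))
    else 0

/-- The operator `Y_{a,b}(ū,v̄)` of the paper (`Y(2|1)` case). -/
def Y (c : ℂ) (T : Fin 3 → Fin 3 → ℂ → A) (u v : List ℂ) : A :=
  ∑ S : Finset (Fin u.length), ∑ Q : Finset (Fin v.length),
    if S.card = Q.card then
      (KizL c (sel v Q) (sel u S) * prodFF c (sel u S) (sel u Sᶜ) *
          prodGG c (sel v Qᶜ) (sel v Q)) •
        (TT c (T 0 2) (sel v Q) * TT c (T 1 2) (sel v Qᶜ) *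
          Tprod (T 0 1) (sel u Sᶜ) * Tprod (T 1 1) (sel u S))
    else 0

/-- First explicit expression for the `Y(2|1)` Bethe vector (operator part,
the weights `λ₂` included as scalars). -/
def PhiA (c : ℂ) (T : Fin 3 → Fin 3 → ℂ → A) (lam2 : ℂ → ℂ) (u v : List ℂ) : A :=
  ∑ S : Finset (Fin u.length), ∑ Q : Finset (Fin v.length),
    if S.card = Q.card then
      (prodGG c (sel v Q) (sel u S) * prodFF c (sel u S) (sel u Sᶜ) *
          prodGG c (sel v Qᶜ) (sel v Q) * prodHHne c (sel u S) * lamP lam2 (sel v Q)) •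
        (TT c (T 0 2) (sel u S) * Tprod (T 0 1) (sel u Sᶜ) * TT c (T 1 2) (sel v Qᶜ))
    else 0

/-- Second explicit expression for the `Y(2|1)` Bethe vector (operator part). -/
def PhiB (c : ℂ) (T : Fin 3 → Fin 3 → ℂ → A) (lam2 : ℂ → ℂ) (u v : List ℂ) : A :=
  ∑ S : Finset (Fin u.length), ∑ Q : Finset (Fin v.length),
    if S.card = Q.card then
      (KizL c (sel v Q) (sel u S) * prodFF c (sel u S) (sel u Sᶜ) *
          prodGG c (sel v Qᶜ) (sel v Q) * lamP lam2 (sel u S)) •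
        (TT c (T 0 2) (sel v Q) * TT c (T 1 2) (sel v Qᶜ) * Tprod (T 0 1) (sel u Sᶜ))
    else 0

/-- First explicit expression for the `Y(1|2)` Bethe vector, without the overall
sign `(-1)^b` (operator part). -/
def PhiTA (c : ℂ) (T : Fin 3 → Fin 3 → ℂ → A) (lam2 : ℂ → ℂ) (u v : List ℂ) : A :=
  ∑ S : Finset (Fin u.length), ∑ Q : Finset (Fin v.length),
    if S.card = Q.card then
      (prodGG c (sel u S) (sel v Q) * prodFF c (sel v Q) (sel v Qᶜ) *
          prodGG c (sel u Sᶜ) (sel u S) * prodHHne c (sel v Q) * lamP lam2 (sel u S)) •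
        (TT c (T 0 2) (sel v Q) * Tprod (T 1 2) (sel v Qᶜ) * TT c (T 0 1) (sel u Sᶜ))
    else 0

/-- Second explicit expression for the `Y(1|2)` Bethe vector, without the overall
sign `(-1)^b` (operator part). -/
def PhiTB (c : ℂ) (T : Fin 3 → Fin 3 → ℂ → A) (lam2 : ℂ → ℂ) (u v : List ℂ) : A :=
  ∑ S : Finset (Fin u.length), ∑ Q : Finset (Fin v.length),
    if S.card = Q.card then
      (KizL c (sel u S) (sel v Q) * prodFF c (sel v Q) (sel v Qᶜ) *
          prodGG c (sel u Sᶜ) (sel u S) * lamP lam2 (sel v Q)) •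
        (TT c (T 0 2) (sel u S) * TT c (T 0 1) (sel u Sᶜ) * Tprod (T 1 2) (sel v Qᶜ))
    else 0

/-- First explicit expression for the dual `Y(2|1)` Bethe vector, without the
overall sign `(-1)^{b(b-1)/2}`.  `E` is a right `A`-module, i.e. a left
`Aᵐᵒᵖ`-module; `op X • Ωd` is `Ωd · X`. -/
def PsiA {E : Type*} [AddCommGroup E] [Module ℂ E] [Module Aᵐᵒᵖ E]
    (c : ℂ) (T : Fin 3 → Fin 3 → ℂ → A) (lam2 : ℂ → ℂ) (u v : List ℂ) (Ωd : E) : E :=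
  ∑ S : Finset (Fin u.length), ∑ Q : Finset (Fin v.length),
    if S.card = Q.card then
      (prodGG c (sel v Q) (sel u S) * prodFF c (sel u S) (sel u Sᶜ) *
          prodGG c (sel v Qᶜ) (sel v Q) * prodHHne c (sel u S) * lamP lam2 (sel v Q)) •
        (op (TTrev c (T 2 1) (sel v Qᶜ) * Tprod (T 1 0) (sel u Sᶜ) *
              TTrev c (T 2 0) (sel u S)) • Ωd)
    else 0

/-- The dual `Y(2|1)` Bethe vector `Ψ_{a,b}(ū,v̄)`. -/
def Psi {E : Type*} [AddCommGroup E] [Module ℂ E] [Module Aᵐᵒᵖ E]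
    (c : ℂ) (T : Fin 3 → Fin 3 → ℂ → A) (lam2 : ℂ → ℂ) (u v : List ℂ) (Ωd : E) : E :=
  ((-1 : ℂ) ^ (v.length * (v.length - 1) / 2)) • PsiA c T lam2 u v Ωd

/-- Second explicit expression for the dual `Y(2|1)` Bethe vector, without the
overall sign `(-1)^{b(b-1)/2}`. -/
def PsiB {E : Type*} [AddCommGroup E] [Module ℂ E] [Module Aᵐᵒᵖ E]
    (c : ℂ) (T : Fin 3 → Fin 3 → ℂ → A) (lam2 : ℂ → ℂ) (u v : List ℂ) (Ωd : E) : E :=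
  ∑ S : Finset (Fin u.length), ∑ Q : Finset (Fin v.length),
    if S.card = Q.card then
      (KizL c (sel v Q) (sel u S) * prodFF c (sel u S) (sel u Sᶜ) *
          prodGG c (sel v Qᶜ) (sel v Q) * lamP lam2 (sel u S)) •
        (op (Tprod (T 1 0) (sel u Sᶜ) * TTrev c (T 2 1) (sel v Qᶜ) *
              TTrev c (T 2 0) (sel v Q)) • Ωd)
    else 0


set_option linter.unusedSectionVars false

/-! ### Basic facts -/

/-- The quadratic relations used in the proof, for parameters in an admissible set. -/
structure Rel (c : ℂ) (W : Set ℂ) (B C D E : ℂ → A) : Prop where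
  hc : c ≠ 0
  adm : ∀ x ∈ W, ∀ y ∈ W, x ≠ y → x - y + c ≠ 0
  BB : ∀ x ∈ W, ∀ y ∈ W, x ≠ y → B x * B y = B y * B x
  DD : ∀ x ∈ W, ∀ y ∈ W, x ≠ y → D x * D y = D y * D x
  CC : ∀ x ∈ W, ∀ y ∈ W, x ≠ y → hh c y x • (C x * C y) = hh c x y • (C y * C x)
  EE : ∀ x ∈ W, ∀ y ∈ W, x ≠ y → hh c y x • (E x * E y) = hh c x y • (E y * E x)
  EB : ∀ x ∈ W, ∀ y ∈ W, x ≠ y →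
    E x * B y = ff c x y • (B y * E x) + gg c y x • (B x * E y)
  BD : ∀ x ∈ W, ∀ y ∈ W, x ≠ y →
    B x * D y = ff c y x • (D y * B x) + gg c x y • (D x * B y)
  BC : ∀ x ∈ W, ∀ y ∈ W, x ≠ y →
    B x * C y = C y * B x + gg c y x • (D y * E x - D x * E y)
  CD : ∀ x ∈ W, ∀ y ∈ W, x ≠ y →
    C x * D y = ff c x y • (D y * C x) + gg c y x • (D x * C y)
  EC : ∀ x ∈ W, ∀ y ∈ W, x ≠ y →
    E x * C y = (-ff c x y) • (C y * E x) + gg c x y • (C x * E y)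

lemma rel_of_fam (c : ℂ) (hc : c ≠ 0) (T : Fin 3 → Fin 3 → ℂ → A) (hT : IsTFam c p21 T)
    (W : Set ℂ) (adm : ∀ x ∈ W, ∀ y ∈ W, x ≠ y → x - y + c ≠ 0) :
    Rel c W (T 1 0) (T 2 1) (T 1 1) (T 2 0) := by
  have key : ∀ x ∈ W, ∀ y ∈ W, x ≠ y → ∀ a b : A,
      a - b = gg c x y • (a - b) → a = b := by
    intro x hx y hy hxy a b h
    have h1 : (1 - gg c x y) • (a - b) = 0 := by
      rw [sub_smul, one_smul, ← h, sub_self]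
    have h2 : (1 - gg c x y) ≠ 0 := by
      have := adm y hy x hx hxy.symm
      have h3 := sub_ne_zero.2 hxy
      unfold gg
      intro h4
      field_simp at h4
      apply this
      linear_combination -h4
    rcases smul_eq_zero.1 h1 with h | h
    · exact absurd h h2
    · exact sub_eq_zero.1 h
  have key2 : ∀ x ∈ W, ∀ y ∈ W, x ≠ y → ∀ a b : A,
      a + b = gg c x y • (a - b) → hh c y x • a = hh c x y • b := by
    intro x hx y hy hxy a b h
    have h3 := sub_ne_zero.2 hxy
    have e1 : hh c y x = -((x - y) / c) * (1 - gg c x y) := by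
      unfold hh gg; field_simp; ring
    have e2 : hh c x y = ((x - y) / c) * (1 + gg c x y) := by
      unfold hh gg; field_simp
    rw [e1, e2]
    have h' : (1 - gg c x y) • a = -((1 + gg c x y) • b) := by
      rw [← sub_eq_zero] at h ⊢
      rw [← h]; module
    rw [mul_smul, h', mul_smul]; module
  refine ⟨hc, adm, ?_, ?_, ?_, ?_, ?_, ?_, ?_, ?_, ?_⟩
  · intro x hx y hy hxy
    have h := hT 1 0 1 0 x y hxy
    simp [p21] at h
    exact key x hx y hy hxy _ _ h
  · intro x hx y hy hxy
    have h := hT 1 1 1 1 x y hxy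
    simp [p21] at h
    exact key x hx y hy hxy _ _ h
  · intro x hx y hy hxy
    have h := hT 2 1 2 1 x y hxy
    simp [p21] at h
    exact key2 x hx y hy hxy _ _ h
  · intro x hx y hy hxy
    have h := hT 2 0 2 0 x y hxy
    simp [p21] at h
    exact key2 x hx y hy hxy _ _ h
  all_goals
    intro x hx y hy hxy
    have h3 := sub_ne_zero.2 hxy
    have h3' := sub_ne_zero.2 hxy.symm
    have e0 : gg c y x = - gg c x y := by
      unfold gg; rw [← neg_sub x y, div_neg]
    have e1 : ff c x y = 1 + gg c x y := by
      unfold ff gg; field_simp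
    have e2 : ff c y x = 1 - gg c x y := by
      unfold ff gg; field_simp; ring
    simp only [e0, e1, e2]
  · have h := hT 1 0 2 0 y x hxy.symm
    simp [p21, e0] at h
    rw [← sub_eq_zero] at h ⊢
    rw [← neg_eq_zero, ← h]; module
  · have h := hT 1 0 1 1 x y hxy
    simp [p21] at h
    rw [← sub_eq_zero] at h ⊢
    rw [← h]; module
  · have h := hT 1 0 2 1 x y hxy
    simp [p21] at h
    rw [← sub_eq_zero] at h ⊢
    rw [← h]; module
  · have h := hT 1 1 2 1 y x hxy.symm
    simp [p21, e0] at h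
    rw [← sub_eq_zero] at h ⊢
    rw [← neg_eq_zero, ← h]; module
  · have h := hT 2 0 2 1 x y hxy
    simp [p21] at h
    rw [← sub_eq_zero] at h ⊢
    rw [← h]; module

/-- normalised symmetric product over a finset -/
def NP (c : ℂ) (F : ℂ → A) (s : Finset ℂ) : A := TTrev c F s.toList

/-- commutative product over a finset -/
def CP (F : ℂ → A) (s : Finset ℂ) : A := Tprod F s.toList

lemma TTrev_cons (c : ℂ) (F : ℂ → A) (x : ℂ) (l : List ℂ) :
    TTrev c F (x :: l) = ((l.map fun y => hh c x y).prod)⁻¹ • (F x * TTrev c F l) := by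
  simp only [TTrev, Tprod, HnormRev, List.map_cons, List.prod_cons, mul_smul_comm, smul_smul,
    mul_inv]

lemma hh_ne {c : ℂ} (hc : c ≠ 0) {x y : ℂ} (h : x - y + c ≠ 0) : hh c x y ≠ 0 :=
  div_ne_zero h hc

lemma TTrev_perm {c : ℂ} {W : Set ℂ} (hc : c ≠ 0)
    (adm : ∀ x ∈ W, ∀ y ∈ W, x ≠ y → x - y + c ≠ 0) {F : ℂ → A}
    (hF : ∀ x ∈ W, ∀ y ∈ W, x ≠ y → hh c y x • (F x * F y) = hh c x y • (F y * F x))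
    {l l' : List ℂ} (h : l.Perm l') : l.Nodup → (∀ x ∈ l, x ∈ W) →
      TTrev c F l = TTrev c F l' := by
  induction h with
  | nil => intros; rfl
  | cons x h ih =>
    intro hn hw
    rw [TTrev_cons, TTrev_cons, ih (List.nodup_cons.1 hn).2 (fun y hy => hw y (by simp [hy])),
      (h.map _).prod_eq]
  | swap x y l =>
    intro hn hw
    have hxy : y ≠ x := by
      intro h; simp [h] at hn
    have hx : x ∈ W := hw x (by simp)
    have hy : y ∈ W := hw y (by simp)
    have h1 := hF y hy x hx hxy
    have n1 := hh_ne hc (adm y hy x hx hxy)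
    have n2 := hh_ne hc (adm x hx y hy hxy.symm)
    have h2 : F y * F x = ((hh c x y)⁻¹ * hh c y x) • (F x * F y) := by
      rw [mul_smul, ← h1, smul_smul, inv_mul_cancel₀ n2, one_smul]
    simp only [TTrev_cons, List.map_cons, List.prod_cons, mul_smul_comm, smul_smul,
      ← mul_assoc, h2, smul_mul_assoc]
    congr 1
    field_simp
  | trans h1 h2 ih1 ih2 =>
    intro hn hw
    rw [ih1 hn hw, ih2 (h1.nodup_iff.1 hn) (fun x hx => hw x (h1.mem_iff.2 hx))]

lemma Tprod_perm {W : Set ℂ} {F : ℂ → A}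
    (hF : ∀ x ∈ W, ∀ y ∈ W, x ≠ y → F x * F y = F y * F x)
    {l l' : List ℂ} (h : l.Perm l') : l.Nodup → (∀ x ∈ l, x ∈ W) →
      Tprod F l = Tprod F l' := by
  induction h with
  | nil => intros; rfl
  | cons x h ih =>
    intro hn hw
    have := ih (List.nodup_cons.1 hn).2 (fun y hy => hw y (by simp [hy]))
    simp only [Tprod, List.map_cons, List.prod_cons] at this ⊢
    rw [this]
  | swap x y l =>
    intro hn hw
    have hxy : y ≠ x := by
      intro h; simp [h] at hn
    have hx : x ∈ W := hw x (by simp)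
    have hy : y ∈ W := hw y (by simp)
    simp only [Tprod, List.map_cons, List.prod_cons, ← mul_assoc, hF y hy x hx hxy]
  | trans h1 h2 ih1 ih2 =>
    intro hn hw
    rw [ih1 hn hw, ih2 (h1.nodup_iff.1 hn) (fun x hx => hw x (h1.mem_iff.2 hx))]

lemma NP_empty (c : ℂ) (F : ℂ → A) : NP c F ∅ = 1 := by
  simp [NP, TTrev, Tprod, HnormRev]

lemma CP_empty (F : ℂ → A) : CP F ∅ = 1 := by
  simp [CP, Tprod]

lemma NP_eq {c : ℂ} {W : Set ℂ} (hc : c ≠ 0)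
    (adm : ∀ x ∈ W, ∀ y ∈ W, x ≠ y → x - y + c ≠ 0) {F : ℂ → A}
    (hF : ∀ x ∈ W, ∀ y ∈ W, x ≠ y → hh c y x • (F x * F y) = hh c x y • (F y * F x))
    {l : List ℂ} (hn : l.Nodup) (hw : ∀ x ∈ l, x ∈ W) :
    TTrev c F l = NP c F l.toFinset := by
  apply TTrev_perm hc adm hF _ hn hw
  exact (List.perm_ext_iff_of_nodup hn (Finset.nodup_toList _)).2 (by simp)

lemma NP_left {c : ℂ} {W : Set ℂ} (hc : c ≠ 0)
    (adm : ∀ x ∈ W, ∀ y ∈ W, x ≠ y → x - y + c ≠ 0) {F : ℂ → A}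
    (hF : ∀ x ∈ W, ∀ y ∈ W, x ≠ y → hh c y x • (F x * F y) = hh c x y • (F y * F x))
    {x : ℂ} {s : Finset ℂ} (hx : x ∉ s) (hxW : x ∈ W) (hs : ↑s ⊆ W) :
    F x * NP c F s = (∏ y ∈ s, hh c x y) • NP c F (insert x s) := by
  have h1 : TTrev c F (x :: s.toList) = NP c F (insert x s) := by
    rw [NP_eq hc adm hF]
    · simp
    · simp [hx, Finset.nodup_toList]
    · intro y hy
      simp at hy
      rcases hy with rfl | hy
      · exact hxW
      · exact hs hy
  rw [← h1, TTrev_cons, smul_smul]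
  have h2 : (s.toList.map fun y => hh c x y).prod = ∏ y ∈ s, hh c x y := by
    rw [Finset.prod_map_toList]
  rw [h2, mul_inv_cancel₀, one_smul, NP]
  refine Finset.prod_ne_zero_iff.2 fun y hy => hh_ne hc (adm x hxW y (hs hy) ?_)
  rintro rfl; exact hx hy

lemma NP_right {c : ℂ} {W : Set ℂ} (hc : c ≠ 0)
    (adm : ∀ x ∈ W, ∀ y ∈ W, x ≠ y → x - y + c ≠ 0) {F : ℂ → A}
    (hF : ∀ x ∈ W, ∀ y ∈ W, x ≠ y → hh c y x • (F x * F y) = hh c x y • (F y * F x))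
    {x : ℂ} {s : Finset ℂ} (hx : x ∉ s) (hxW : x ∈ W) (hs : ↑s ⊆ W) :
    NP c F s * F x = (∏ y ∈ s, hh c y x) • NP c F (insert x s) := by
  induction s using Finset.induction_on with
  | empty =>
    have := NP_left hc adm hF (Finset.notMem_empty x) hxW (by simp)
    simpa [NP_empty] using this
  | insert y s hy ih =>
    simp only [Finset.mem_insert, not_or] at hx
    have hyW : y ∈ W := hs (by simp)
    have hsW : ↑s ⊆ W := fun z hz => hs (by simp at hz ⊢; right; exact hz)
    have n0 : (∏ z ∈ s, hh c y z) ≠ 0 :=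
      Finset.prod_ne_zero_iff.2 fun z hz => hh_ne hc (adm y hyW z (hsW hz)
        (by rintro rfl; exact hy hz))
    have h1 := NP_left hc adm hF hy hyW hsW
    have h2 := NP_left hc adm hF (x := y) (s := insert x s) (by simp [Ne.symm hx.1, hy]) hyW
      (by intro z hz; simp at hz; rcases hz with rfl | hz; exacts [hxW, hsW hz])
    rw [Finset.prod_insert hx.2] at h2
    apply (smul_right_injective A n0)
    simp only
    rw [← smul_mul_assoc, ← h1, mul_assoc, ih hx.2 hsW, mul_smul_comm, h2,
      Finset.prod_insert hy, Finset.insert_comm]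
    module

lemma CP_eq {W : Set ℂ} {F : ℂ → A}
    (hF : ∀ x ∈ W, ∀ y ∈ W, x ≠ y → F x * F y = F y * F x)
    {l : List ℂ} (hn : l.Nodup) (hw : ∀ x ∈ l, x ∈ W) :
    Tprod F l = CP F l.toFinset := by
  apply Tprod_perm hF _ hn hw
  exact (List.perm_ext_iff_of_nodup hn (Finset.nodup_toList _)).2 (by simp)

lemma CP_left {W : Set ℂ} {F : ℂ → A}
    (hF : ∀ x ∈ W, ∀ y ∈ W, x ≠ y → F x * F y = F y * F x)
    {x : ℂ} {s : Finset ℂ} (hx : x ∉ s) (hxW : x ∈ W) (hs : ↑s ⊆ W) :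
    F x * CP F s = CP F (insert x s) := by
  have h1 : Tprod F (x :: s.toList) = CP F (insert x s) := by
    rw [CP_eq hF]
    · simp
    · simp [hx, Finset.nodup_toList]
    · intro y hy
      simp at hy
      rcases hy with rfl | hy
      · exact hxW
      · exact hs hy
  rw [← h1]
  simp [CP, Tprod]

lemma CP_right {W : Set ℂ} {F : ℂ → A}
    (hF : ∀ x ∈ W, ∀ y ∈ W, x ≠ y → F x * F y = F y * F x)
    {x : ℂ} {s : Finset ℂ} (hx : x ∉ s) (hxW : x ∈ W) (hs : ↑s ⊆ W) :
    CP F s * F x = CP F (insert x s) := by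
  induction s using Finset.induction_on with
  | empty =>
    have := CP_left hF (Finset.notMem_empty x) hxW (by simp)
    simpa [CP_empty] using this
  | insert y s hy ih =>
    simp only [Finset.mem_insert, not_or] at hx
    have hyW : y ∈ W := hs (by simp)
    have hsW : ↑s ⊆ W := fun z hz => hs (by simp at hz ⊢; right; exact hz)
    rw [← CP_left hF hy hyW hsW, mul_assoc, ih hx.2 hsW, CP_left hF, Finset.insert_comm]
    · simp [Ne.symm hx.1, hy]
    · exact hyW
    · intro z hz; simp at hz; rcases hz with rfl | hz; exacts [hxW, hsW hz]


/-! ### Partial fractions -/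

lemma pf_general (s : Finset ℂ) (P : Polynomial ℂ) (hP : P.degree < s.card) (z : ℂ)
    (hz : z ∉ s) :
    P.eval z * ∏ x ∈ s, (z - x)⁻¹ =
      ∑ x ∈ s, P.eval x * (z - x)⁻¹ * ∏ y ∈ s.erase x, (x - y)⁻¹ := by
  have h1 := Lagrange.eq_interpolate (v := fun x : ℂ => x) (s := s) (f := P)
    (fun _ _ _ _ h => h) hP
  have hx : ∀ i ∈ s, z ≠ (fun x : ℂ => x) i := by
    rintro i hi rfl; exact hz hi
  have h2 := congrArg (Polynomial.eval z) h1
  rw [Lagrange.eval_interpolate_not_at_node _ hx] at h2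
  have h3 : ∏ x ∈ s, (z - x) ≠ 0 :=
    Finset.prod_ne_zero_iff.2 fun x hx' => sub_ne_zero.2 (hx x hx')
  rw [h2, Lagrange.eval_nodal, Finset.prod_inv_distrib]
  rw [mul_comm, ← mul_assoc, inv_mul_cancel₀ h3, one_mul]
  refine Finset.sum_congr rfl fun x _ => ?_
  rw [Lagrange.nodalWeight]
  ring

lemma degree_prod_linear {ι : Type*} (t : Finset ι) (a b : ι → ℂ) :
    (∏ i ∈ t, (Polynomial.C (a i) * Polynomial.X + Polynomial.C (b i))).natDegree ≤ t.card := by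
  refine (Polynomial.natDegree_prod_le _ _).trans ?_
  refine (Finset.sum_le_card_nsmul _ _ 1 fun i _ => Polynomial.natDegree_linear_le).trans ?_
  simp

lemma eval_prod_linear {ι : Type*} (t : Finset ι) (a b : ι → ℂ) (z : ℂ) :
    (∏ i ∈ t, (Polynomial.C (a i) * Polynomial.X + Polynomial.C (b i))).eval z
      = ∏ i ∈ t, (a i * z + b i) := by
  simp [Polynomial.eval_prod]

lemma pf1 {c : ℂ} (hc : c ≠ 0) (J K Q : Finset ℂ) (z : ℂ) (hzK : z ∉ K) (hzQ : z ∉ Q)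
    (hKQ : Disjoint K Q) (hcard : Q.card = J.card + 1) :
    (∏ k ∈ K, ff c z k) * (∏ j ∈ J, hh c z j) * (∏ q ∈ Q, gg c q z) =
      (∑ i ∈ K, gg c z i * (∏ k ∈ K.erase i, ff c i k) * (∏ j ∈ J, hh c i j) *
        (∏ q ∈ Q, gg c q i)) +
      ∑ q ∈ Q, gg c q z * (∏ k ∈ K, ff c q k) * (∏ j ∈ J, hh c q j) *
        (∏ r ∈ Q.erase q, gg c r q) := by
  classical
  set P : Polynomial ℂ :=
    Polynomial.C (∏ q ∈ Q, (-c)) *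
    ((∏ i ∈ K, (Polynomial.C 1 * Polynomial.X + Polynomial.C (-i + c))) *
    (∏ j ∈ J, (Polynomial.C c⁻¹ * Polynomial.X + Polynomial.C ((-j + c) / c)))) with hPdef
  have hPe : ∀ x, P.eval x = (∏ q ∈ Q, (-c)) * ((∏ i ∈ K, (x - i + c)) * ∏ j ∈ J, hh c x j) := by
    intro x
    rw [hPdef]
    simp only [Polynomial.eval_mul, Polynomial.eval_C, eval_prod_linear]
    congr 2
    · exact Finset.prod_congr rfl fun i _ => by ring
    · exact Finset.prod_congr rfl fun i _ => by unfold hh; field_simp; ring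
  have hdeg : P.degree < (K ∪ Q).card := by
    rw [Finset.card_union_of_disjoint hKQ]
    refine lt_of_le_of_lt Polynomial.degree_le_natDegree ?_
    have : P.natDegree ≤ K.card + J.card := by
      refine (Polynomial.natDegree_C_mul_le _ _).trans ?_
      refine Polynomial.natDegree_mul_le.trans ?_
      exact add_le_add (degree_prod_linear _ _ _) (degree_prod_linear _ _ _)
    exact_mod_cast (show P.natDegree < K.card + Q.card by omega)
  have key := pf_general (K ∪ Q) P hdeg z (by simp [hzK, hzQ])
  rw [Finset.sum_union hKQ, Finset.prod_union hKQ] at key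
  have e1 : ∀ x : ℂ, ∏ q ∈ Q, gg c q x = (∏ q ∈ Q, (-c)) * ∏ q ∈ Q, (x - q)⁻¹ := by
    intro x
    rw [← Finset.prod_mul_distrib]
    refine Finset.prod_congr rfl fun q _ => ?_
    unfold gg
    rw [← neg_sub x q, div_neg, neg_mul, div_eq_mul_inv]
  have e1' : ∀ x : ℂ, ∀ s : Finset ℂ, ∏ q ∈ s, gg c q x
      = (∏ q ∈ s, (-c)) * ∏ q ∈ s, (x - q)⁻¹ := by
    intro x s
    rw [← Finset.prod_mul_distrib]
    refine Finset.prod_congr rfl fun q _ => ?_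
    unfold gg
    rw [← neg_sub x q, div_neg, neg_mul, div_eq_mul_inv]
  have e2 : ∀ x : ℂ, ∀ s : Finset ℂ, ∏ k ∈ s, ff c x k
      = (∏ k ∈ s, (x - k + c)) * ∏ k ∈ s, (x - k)⁻¹ := by
    intro x s
    rw [← Finset.prod_mul_distrib]
    exact Finset.prod_congr rfl fun q _ => by unfold ff; rw [div_eq_mul_inv]
  have hL : (∏ k ∈ K, ff c z k) * (∏ j ∈ J, hh c z j) * (∏ q ∈ Q, gg c q z) =
      P.eval z * ((∏ x ∈ K, (z - x)⁻¹) * ∏ x ∈ Q, (z - x)⁻¹) := by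
    rw [hPe, e1, e2]; ring
  rw [hL, key]
  congr 1
  · refine Finset.sum_congr rfl fun i hi => ?_
    have hiQ : i ∉ Q := Finset.disjoint_left.1 hKQ hi
    have h1 : (K ∪ Q).erase i = (K.erase i) ∪ Q := by
      rw [Finset.erase_union_distrib, Finset.erase_eq_of_notMem hiQ]
    have h2 : Disjoint (K.erase i) Q := hKQ.mono_left (Finset.erase_subset _ _)
    rw [h1, Finset.prod_union h2, hPe, e1', e2, ← Finset.mul_prod_erase K _ hi]
    simp only [gg, div_eq_mul_inv, sub_self, zero_add]
    ring
  · refine Finset.sum_congr rfl fun q hq => ?_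
    have hqK : q ∉ K := Finset.disjoint_right.1 hKQ hq
    have h1 : (K ∪ Q).erase q = K ∪ Q.erase q := by
      rw [Finset.erase_union_distrib, Finset.erase_eq_of_notMem hqK]
    have h2 : Disjoint K (Q.erase q) := hKQ.mono_right (Finset.erase_subset _ _)
    have h3 : gg c q z = (-c) * (z - q)⁻¹ := by
      unfold gg; rw [← neg_sub z q, div_neg, neg_mul, div_eq_mul_inv]
    rw [h1, Finset.prod_union h2, hPe, e1', e2, h3, ← Finset.mul_prod_erase Q _ hq]
    ring

lemma pf2 {c : ℂ} (hc : c ≠ 0) (K : Finset ℂ) (z v : ℂ) (hzK : z ∉ K) (hzv : z ≠ v)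
    (hvK : v ∉ K) :
    gg c v z * (∏ k ∈ K, ff c z k) =
      (∑ i ∈ K, gg c z i * (∏ k ∈ K.erase i, ff c i k) * gg c v i) +
      gg c v z * (∏ k ∈ K, ff c v k) := by
  have := pf1 hc ∅ K {v} z hzK (by simpa using hzv) (by simpa using hvK) (by simp)
  simp only [Finset.prod_empty, mul_one, Finset.prod_singleton, Finset.sum_singleton,
    Finset.erase_singleton] at this
  rw [← this]; ring

lemma pf3 {c : ℂ} {ι : Type*} (I : Finset ι) (w : ι → ℂ) (J : Finset ℂ)
    (z q : ℂ) (hzJ : z ∉ J) (hqJ : q ∉ J) (hzq : z ≠ q) (hcard : I.card ≤ J.card) :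
    gg c q z * (∏ i ∈ I, hh c (w i) z) * (∏ k ∈ J, gg c z k) =
      gg c q z * (∏ i ∈ I, hh c (w i) q) * (∏ k ∈ J, gg c q k) +
      ∑ k ∈ J, gg c z k * (∏ l ∈ J.erase k, gg c k l) *
        (gg c q k * ∏ i ∈ I, hh c (w i) k) := by
  classical
  set P : Polynomial ℂ :=
    Polynomial.C (-c * ∏ q ∈ J, c) *
    (∏ i ∈ I, (Polynomial.C (-c⁻¹) * Polynomial.X + Polynomial.C ((w i + c) / c))) with hPdef
  have hPe : ∀ x, P.eval x = (-c * ∏ q ∈ J, c) * (∏ i ∈ I, hh c (w i) x) := by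
    intro x
    rw [hPdef]
    simp only [Polynomial.eval_mul, Polynomial.eval_C, eval_prod_linear]
    congr 1
    exact Finset.prod_congr rfl fun i _ => by unfold hh; rw [div_eq_mul_inv, div_eq_mul_inv]; ring
  have hdeg : P.degree < (insert q J).card := by
    rw [Finset.card_insert_of_notMem hqJ]
    refine lt_of_le_of_lt Polynomial.degree_le_natDegree ?_
    have : P.natDegree ≤ I.card := by
      refine (Polynomial.natDegree_C_mul_le _ _).trans ?_
      exact (degree_prod_linear _ _ _)
    exact_mod_cast (show P.natDegree < J.card + 1 by omega)
  have key := pf_general (insert q J) P hdeg z (by simp [hzJ, hzq])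
  rw [Finset.sum_insert hqJ, Finset.prod_insert hqJ, Finset.erase_insert hqJ] at key
  have e1 : ∀ x : ℂ, ∀ s : Finset ℂ, ∏ k ∈ s, gg c x k
      = (∏ k ∈ s, c) * ∏ k ∈ s, (x - k)⁻¹ := by
    intro x s
    rw [← Finset.prod_mul_distrib]
    exact Finset.prod_congr rfl fun q _ => by unfold gg; rw [div_eq_mul_inv]
  have h3 : ∀ x, gg c q x = (-c) * (x - q)⁻¹ := by
    intro x
    unfold gg; rw [← neg_sub x q, div_neg, neg_mul, div_eq_mul_inv]
  have hL : gg c q z * (∏ i ∈ I, hh c (w i) z) * (∏ k ∈ J, gg c z k) =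
      P.eval z * ((z - q)⁻¹ * ∏ x ∈ J, (z - x)⁻¹) := by
    rw [hPe, e1, h3]; ring
  rw [hL, key]
  congr 1
  · rw [hPe, e1, h3]; ring
  · refine Finset.sum_congr rfl fun k hk => ?_
    have hkq : q ≠ k := by rintro rfl; exact hqJ hk
    rw [Finset.erase_insert_of_ne hkq, Finset.prod_insert (by simp [hqJ]), hPe, e1, h3,
      ← Finset.mul_prod_erase J (fun _ => c) hk]
    simp only [gg, div_eq_mul_inv]
    ring

/-! ### The Izergin kernel -/

/-- `∏_{j>k} g(vⱼ,vₖ)` -/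
def VP (c : ℂ) {n : ℕ} (v : Fin n → ℂ) : ℂ :=
  ∏ j : Fin n, ∏ k : Fin n, if (k : ℕ) < (j : ℕ) then gg c (v j) (v k) else 1

/-- `∏_{j>k} g(uₖ,uⱼ)` -/
def VQ (c : ℂ) {n : ℕ} (u : Fin n → ℂ) : ℂ :=
  ∏ j : Fin n, ∏ k : Fin n, if (k : ℕ) < (j : ℕ) then gg c (u k) (u j) else 1

lemma Kiz_def (c : ℂ) {n : ℕ} (v u : Fin n → ℂ) :
    Kiz c v u = VP c v * VQ c u * (∏ j : Fin n, ∏ k : Fin n, hh c (v j) (u k)) *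
      Matrix.det (Matrix.of fun j k => gg c (v j) (u k) / hh c (v j) (u k)) := rfl

lemma VQ_eq (c : ℂ) {n : ℕ} (u : Fin n → ℂ) : VQ c u = VP c (fun i => - u i) := by
  unfold VQ VP
  refine Finset.prod_congr rfl fun j _ => Finset.prod_congr rfl fun k _ => ?_
  congr 1
  unfold gg
  congr 1
  ring

lemma VP_vandermonde (c : ℂ) {n : ℕ} (v : Fin n → ℂ) :
    VP c v = (∏ j : Fin n, ∏ k : Fin n, if (k : ℕ) < (j : ℕ) then c else 1) *
      (Matrix.vandermonde v).det⁻¹ := by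
  rw [Matrix.det_vandermonde, ← Finset.prod_inv_distrib]
  simp_rw [← Finset.prod_inv_distrib]
  have h1 : ∏ i : Fin n, ∏ j ∈ Finset.Ioi i, (v j - v i)⁻¹ =
      ∏ j : Fin n, ∏ k : Fin n, if (k : ℕ) < (j : ℕ) then (v j - v k)⁻¹ else 1 := by
    rw [Finset.prod_comm]
    refine Finset.prod_congr rfl fun i _ => ?_
    rw [← Finset.prod_filter]
    refine Finset.prod_congr ?_ fun _ _ => rfl
    ext j; simp
  rw [h1, ← Finset.prod_mul_distrib]
  refine Finset.prod_congr rfl fun j _ => ?_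
  rw [← Finset.prod_mul_distrib]
  refine Finset.prod_congr rfl fun k _ => ?_
  split_ifs
  · unfold gg; rw [div_eq_mul_inv]
  · simp

lemma VP_perm (c : ℂ) {n : ℕ} (v : Fin n → ℂ) (σ : Equiv.Perm (Fin n)) :
    VP c (v ∘ σ) = ((Equiv.Perm.sign σ : ℤ) : ℂ) * VP c v := by
  rw [VP_vandermonde, VP_vandermonde]
  have h : Matrix.vandermonde (v ∘ σ) = (Matrix.vandermonde v).submatrix σ id := by
    ext i j; simp [Matrix.vandermonde]
  rw [h, Matrix.det_permute, mul_inv]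
  have : (((Equiv.Perm.sign σ : ℤ) : ℂ))⁻¹ = ((Equiv.Perm.sign σ : ℤ) : ℂ) := by
    rcases Int.units_eq_one_or (Equiv.Perm.sign σ) with h | h <;> simp [h]
  rw [this]; ring

lemma VQ_perm (c : ℂ) {n : ℕ} (u : Fin n → ℂ) (σ : Equiv.Perm (Fin n)) :
    VQ c (u ∘ σ) = ((Equiv.Perm.sign σ : ℤ) : ℂ) * VQ c u := by
  rw [VQ_eq, VQ_eq, ← VP_perm]; rfl

lemma Kiz_perm (c : ℂ) {n : ℕ} (v u : Fin n → ℂ) (σ τ : Equiv.Perm (Fin n)) :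
    Kiz c (v ∘ σ) (u ∘ τ) = Kiz c v u := by
  rw [Kiz_def, Kiz_def, VP_perm, VQ_perm]
  have h1 : (∏ j : Fin n, ∏ k : Fin n, hh c ((v ∘ σ) j) ((u ∘ τ) k)) =
      ∏ j : Fin n, ∏ k : Fin n, hh c (v j) (u k) := by
    rw [← Equiv.prod_comp σ (fun j => ∏ k, hh c (v j) (u k))]
    refine Finset.prod_congr rfl fun j _ => ?_
    rw [← Equiv.prod_comp τ (fun k => hh c (v (σ j)) (u k))]
    rfl
  set M : Matrix (Fin n) (Fin n) ℂ :=
    Matrix.of fun j k => gg c (v j) (u k) / hh c (v j) (u k) with hM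
  have h2 : (Matrix.of fun j k => gg c ((v ∘ σ) j) ((u ∘ τ) k) / hh c ((v ∘ σ) j) ((u ∘ τ) k)) =
      (M.submatrix σ id).submatrix id τ := by
    ext i j; simp [hM]
  rw [h1, h2, Matrix.det_permute', Matrix.det_permute]
  have hs : ∀ ρ : Equiv.Perm (Fin n),
      ((Equiv.Perm.sign ρ : ℤ) : ℂ) * ((Equiv.Perm.sign ρ : ℤ) : ℂ) = 1 := by
    intro ρ
    rcases Int.units_eq_one_or (Equiv.Perm.sign ρ) with h | h <;> simp [h]
  linear_combination (VP c v * VQ c u * (∏ j : Fin n, ∏ k : Fin n, hh c (v j) (u k)) * M.det) *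
    (((Equiv.Perm.sign σ : ℤ) : ℂ) * ((Equiv.Perm.sign σ : ℤ) : ℂ) * hs τ + hs σ)

lemma exists_perm_of_range {n : ℕ} {v v' : Fin n → ℂ} (h : Function.Injective v)
    (h' : Function.Injective v') (hr : Set.range v = Set.range v') :
    ∃ σ : Equiv.Perm (Fin n), v' = v ∘ σ := by
  refine ⟨(Equiv.ofInjective v' h').trans ((Equiv.setCongr hr.symm).trans
    (Equiv.ofInjective v h).symm), ?_⟩
  funext i
  simp only [Function.comp, Equiv.trans_apply]
  rw [Equiv.apply_ofInjective_symm h]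
  simp

lemma Kiz_range (c : ℂ) {n : ℕ} {v u v' u' : Fin n → ℂ} (hv : Function.Injective v)
    (hv' : Function.Injective v') (hu : Function.Injective u) (hu' : Function.Injective u')
    (h1 : Set.range v = Set.range v') (h2 : Set.range u = Set.range u') :
    Kiz c v u = Kiz c v' u' := by
  obtain ⟨σ, rfl⟩ := exists_perm_of_range hv hv' h1
  obtain ⟨τ, rfl⟩ := exists_perm_of_range hu hu' h2
  rw [Kiz_perm]

lemma KizL_eq (c : ℂ) {n : ℕ} {v u : Fin n → ℂ} (hv : Function.Injective v)
    (hu : Function.Injective u) {l l' : List ℂ} (hl : l.Nodup) (hl' : l'.Nodup)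
    (h : ∀ x, x ∈ l ↔ x ∈ Set.range v) (h' : ∀ x, x ∈ l' ↔ x ∈ Set.range u) :
    KizL c l l' = Kiz c v u := by
  have hn : l.length = n := by
    rw [← List.toFinset_card_of_nodup hl]
    have : l.toFinset = Finset.univ.image v := by ext x; simp [h x]
    rw [this, Finset.card_image_of_injective _ hv]; simp
  have hn' : l'.length = n := by
    rw [← List.toFinset_card_of_nodup hl']
    have : l'.toFinset = Finset.univ.image u := by ext x; simp [h' x]
    rw [this, Finset.card_image_of_injective _ hu]; simp
  subst hn
  unfold KizL
  rw [dif_pos hn'.symm]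
  apply Kiz_range
  · exact List.nodup_iff_injective_get.1 hl
  · exact hv
  · exact (List.nodup_iff_injective_get.1 hl').comp (Fin.cast_injective _)
  · exact hu
  · ext x; rw [← h x, List.mem_iff_get]; rfl
  · ext x; rw [← h' x, List.mem_iff_get]
    constructor
    · rintro ⟨i, rfl⟩; exact ⟨_, rfl⟩
    · rintro ⟨i, rfl⟩; exact ⟨Fin.cast hn' i, rfl⟩

/-- Izergin kernel on finsets -/
def KK (c : ℂ) (Q S : Finset ℂ) : ℂ := KizL c Q.toList S.toList

lemma KizL_eq_KK (c : ℂ) {l l' : List ℂ} (hl : l.Nodup) (hl' : l'.Nodup) :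
    KizL c l l' = KK c l.toFinset l'.toFinset := by
  by_cases h : l.length = l'.length
  · unfold KK
    rw [KizL_eq c (v := l.get) (u := fun j => l'.get (Fin.cast h j))
      (List.nodup_iff_injective_get.1 hl)
      ((List.nodup_iff_injective_get.1 hl').comp (Fin.cast_injective _))
      (Finset.nodup_toList _) (Finset.nodup_toList _)]
    · unfold KizL; rw [dif_pos h]
    · intro x; simp only [Finset.mem_toList, List.mem_toFinset]; rw [List.mem_iff_get]; rfl
    · intro x; simp only [Finset.mem_toList, List.mem_toFinset]; rw [List.mem_iff_get]
      constructor
      · rintro ⟨i, rfl⟩; exact ⟨Fin.cast h.symm i, rfl⟩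
      · rintro ⟨i, rfl⟩; exact ⟨_, rfl⟩
  · unfold KK KizL
    rw [dif_neg h, dif_neg]
    simpa [List.toFinset_card_of_nodup hl, List.toFinset_card_of_nodup hl'] using h

lemma VP_succAbove (c : ℂ) {n : ℕ} (v : Fin (n + 1) → ℂ) (j : Fin (n + 1)) :
    VP c v = (-1) ^ (j : ℕ) * (∏ i : Fin n, gg c (v (j.succAbove i)) (v j)) *
      VP c (fun i => v (j.succAbove i)) := by
  unfold VP
  rw [Fin.prod_univ_succAbove _ j]
  simp_rw [Fin.prod_univ_succAbove _ j]
  rw [Finset.prod_mul_distrib]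
  simp only [lt_irrefl, if_false, one_mul, ← mul_assoc]
  rw [← Finset.prod_mul_distrib]
  congr 1
  · have h1 : ((-1 : ℂ)) ^ (j : ℕ) = ∏ i : Fin n, if (j.succAbove i : ℕ) < (j : ℕ) then -1 else 1 := by
      rw [Finset.prod_ite]
      simp only [Finset.prod_const, one_pow, mul_one]
      congr 1
      have : (Finset.univ.filter fun i : Fin n => (j.succAbove i : ℕ) < (j : ℕ))
          = Finset.univ.filter fun i : Fin n => (i : ℕ) < (j : ℕ) := by
        ext i
        simp only [Finset.mem_filter, Finset.mem_univ, true_and]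
        exact Fin.succAbove_lt_iff_castSucc_lt j i
      rw [this, Fin.card_filter_val_lt]
      omega
    rw [h1, ← Finset.prod_mul_distrib]
    refine Finset.prod_congr rfl fun i _ => ?_
    have hne : (j.succAbove i : ℕ) ≠ (j : ℕ) := fun h => Fin.succAbove_ne j i (Fin.ext h)
    have hg : gg c (v j) (v (j.succAbove i)) = - gg c (v (j.succAbove i)) (v j) := by
      unfold gg; rw [← neg_sub, div_neg]
    rcases lt_or_gt_of_ne hne with h | h
    · rw [if_pos h, if_neg (by omega), if_pos h, hg]; ring
    · rw [if_neg (by omega), if_pos h, if_neg (by omega)]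
  · refine Finset.prod_congr rfl fun i _ => Finset.prod_congr rfl fun k _ => ?_
    have : ((j.succAbove k : ℕ) < (j.succAbove i : ℕ)) ↔ (k : ℕ) < (i : ℕ) :=
      (Fin.strictMono_succAbove j).lt_iff_lt (a := k) (b := i)
    simp only [this]

lemma VQ_cons (c : ℂ) {n : ℕ} (u : Fin n → ℂ) (z : ℂ) :
    VQ c (Fin.cons z u : Fin (n + 1) → ℂ) = (∏ k : Fin n, gg c z (u k)) * VQ c u := by
  unfold VQ
  rw [Fin.prod_univ_succ]
  simp_rw [Fin.prod_univ_succ]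
  rw [Finset.prod_mul_distrib]
  simp

/-- coefficients of the Laplace expansion -/
def mco (c : ℂ) {n : ℕ} (v : Fin (n + 1) → ℂ) (u : Fin n → ℂ) (j : Fin (n + 1)) : ℂ :=
  (∏ i : Fin n, gg c (v (j.succAbove i)) (v j)) * (∏ k : Fin n, hh c (v j) (u k)) *
    Kiz c (fun i => v (j.succAbove i)) u

lemma laplace (c : ℂ) {n : ℕ} (v : Fin (n + 1) → ℂ) (u : Fin n → ℂ) (x : ℂ)
    (hx : ∀ j, hh c (v j) x ≠ 0) :
    VP c v * VQ c u * (∏ j : Fin (n + 1), ∏ k : Fin n, hh c (v j) (u k)) *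
      (∏ j, hh c (v j) x) *
      Matrix.det (Matrix.of fun j k => gg c (v j) ((Fin.cons x u : Fin (n + 1) → ℂ) k) /
        hh c (v j) ((Fin.cons x u : Fin (n + 1) → ℂ) k)) =
    ∑ j, mco c v u j * (gg c (v j) x * ∏ i : Fin n, hh c (v (j.succAbove i)) x) := by
  rw [Matrix.det_succ_column_zero, Finset.mul_sum]
  refine Finset.sum_congr rfl fun j _ => ?_
  have hsub : (Matrix.submatrix (Matrix.of fun j k => gg c (v j) ((Fin.cons x u : Fin (n + 1) → ℂ) k) /
        hh c (v j) ((Fin.cons x u : Fin (n + 1) → ℂ) k)) j.succAbove Fin.succ) =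
      Matrix.of fun i k => gg c (v (j.succAbove i)) (u k) / hh c (v (j.succAbove i)) (u k) := by
    ext i k; simp
  rw [hsub, VP_succAbove c v j, mco, Kiz_def, Fin.prod_univ_succAbove _ j,
    Fin.prod_univ_succAbove (fun j => hh c (v j) x) j]
  simp only [Matrix.of_apply, Fin.cons_zero]
  have hs : ((-1 : ℂ) ^ (j : ℕ)) * (-1) ^ (j : ℕ) = 1 := by
    rw [← mul_pow]; simp
  have h0 : hh c (v j) x * (gg c (v j) x / hh c (v j) x) = gg c (v j) x := by
    field_simp [hx j]
  generalize Matrix.det (Matrix.of fun i k => gg c (v (j.succAbove i)) (u k) /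
    hh c (v (j.succAbove i)) (u k)) = dd
  generalize gg c (v j) x / hh c (v j) x = q at *
  rw [← h0]
  linear_combination (∏ i : Fin n, gg c (v (j.succAbove i)) (v j)) *
      VP c (fun i => v (j.succAbove i)) * VQ c u *
      ((∏ k : Fin n, hh c (v j) (u k)) * ∏ i : Fin n, ∏ k : Fin n, hh c (v (j.succAbove i)) (u k)) *
      (hh c (v j) x * ∏ i : Fin n, hh c (v (j.succAbove i)) x) * q * dd * hs

lemma Kiz_rec {c : ℂ} (hc : c ≠ 0) {n : ℕ} (v : Fin (n + 1) → ℂ) (u : Fin n → ℂ) (z : ℂ)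
    (hv : Function.Injective v) (hu : Function.Injective u) (hzu : ∀ k, z ≠ u k)
    (hzv : ∀ j, z ≠ v j) (hvu : ∀ j k, v j ≠ u k)
    (hz : ∀ j, hh c (v j) z ≠ 0) (hh' : ∀ j k, hh c (v j) (u k) ≠ 0) :
    Kiz c v (Fin.cons z u : Fin (n + 1) → ℂ) =
      ∑ j, gg c (v j) z * (∏ k, ff c (v j) (u k)) *
        (∏ i : Fin n, ff c (v (j.succAbove i)) (v j)) * Kiz c (fun i => v (j.succAbove i)) u := by
  classical
  have hff : ∀ x y : ℂ, x ≠ y → ff c x y = gg c x y * hh c x y := by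
    intro x y h
    have := sub_ne_zero.2 h
    unfold ff gg hh; field_simp
  have hvan : ∀ k, ∑ j, mco c v u j * (gg c (v j) (u k) *
      ∏ i : Fin n, hh c (v (j.succAbove i)) (u k)) = 0 := by
    intro k
    rw [← laplace c v u (u k) (fun j => hh' j k)]
    have hdet : Matrix.det (Matrix.of fun j k' => gg c (v j)
        ((Fin.cons (u k) u : Fin (n + 1) → ℂ) k') /
        hh c (v j) ((Fin.cons (u k) u : Fin (n + 1) → ℂ) k')) = 0 :=
      Matrix.det_zero_of_column_eq (R := ℂ) (i := (0 : Fin (n + 1))) (j := k.succ)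
        (Fin.succ_ne_zero k).symm (fun i => by simp)
    rw [hdet, mul_zero]
  have h1 : Kiz c v (Fin.cons z u : Fin (n + 1) → ℂ) = (∏ k : Fin n, gg c z (u k)) *
      ∑ j, mco c v u j * (gg c (v j) z * ∏ i : Fin n, hh c (v (j.succAbove i)) z) := by
    rw [← laplace c v u z hz, Kiz_def, VQ_cons]
    have : (∏ j : Fin (n + 1), ∏ k : Fin (n + 1),
        hh c (v j) ((Fin.cons z u : Fin (n + 1) → ℂ) k)) =
        (∏ j, hh c (v j) z) * ∏ j : Fin (n + 1), ∏ k : Fin n, hh c (v j) (u k) := by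
      rw [← Finset.prod_mul_distrib]
      refine Finset.prod_congr rfl fun j _ => ?_
      rw [Fin.prod_univ_succ]; simp
    rw [this]; ring
  have hJ : ∀ F : ℂ → ℂ, ∏ k ∈ Finset.univ.image u, F k = ∏ k, F (u k) :=
    fun F => Finset.prod_image fun _ _ _ _ h => hu h
  have h2 : ∀ j, (∏ k : Fin n, gg c z (u k)) *
      (gg c (v j) z * ∏ i : Fin n, hh c (v (j.succAbove i)) z) =
      gg c (v j) z * (∏ i : Fin n, hh c (v (j.succAbove i)) (v j)) * (∏ k, gg c (v j) (u k)) +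
      ∑ k ∈ Finset.univ.image u, gg c z k * (∏ l ∈ (Finset.univ.image u).erase k, gg c k l) *
        (gg c (v j) k * ∏ i : Fin n, hh c (v (j.succAbove i)) k) := by
    intro j
    have := pf3 (c := c) Finset.univ (fun i : Fin n => v (j.succAbove i)) (Finset.univ.image u)
      z (v j) (by simp; exact fun k => (hzu k).symm) (by simp; exact fun k => (hvu j k).symm)
      (hzv j) (by rw [Finset.card_image_of_injective _ hu])
    rw [hJ, hJ] at this
    rw [← this]; ring
  rw [h1, Finset.mul_sum]
  have h3 : ∀ j, (∏ k : Fin n, gg c z (u k)) * (mco c v u j * (gg c (v j) z *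
      ∏ i : Fin n, hh c (v (j.succAbove i)) z)) =
      gg c (v j) z * (∏ k, ff c (v j) (u k)) *
        (∏ i : Fin n, ff c (v (j.succAbove i)) (v j)) * Kiz c (fun i => v (j.succAbove i)) u +
      ∑ k ∈ Finset.univ.image u, gg c z k * (∏ l ∈ (Finset.univ.image u).erase k, gg c k l) *
        (mco c v u j * (gg c (v j) k * ∏ i : Fin n, hh c (v (j.succAbove i)) k)) := by
    intro j
    have e : ∀ a b d : ℂ, a * (b * d) = b * (a * d) := fun a b d => by ring
    rw [e, h2 j, mul_add, Finset.mul_sum]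
    congr 1
    · rw [Finset.prod_congr rfl fun k _ => hff (v j) (u k) (hvu j k),
        Finset.prod_congr rfl fun i _ => hff (v (j.succAbove i)) (v j)
          (fun h => Fin.succAbove_ne j i (hv h)), Finset.prod_mul_distrib,
        Finset.prod_mul_distrib, mco]
      ring
    · exact Finset.sum_congr rfl fun k _ => by ring
  rw [Finset.sum_congr rfl fun j _ => h3 j, Finset.sum_add_distrib, Finset.sum_comm]
  rw [add_eq_left]
  refine Finset.sum_eq_zero fun k hk => ?_
  obtain ⟨k, -, rfl⟩ := Finset.mem_image.1 hk
  rw [← Finset.mul_sum, hvan, mul_zero]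

lemma KK_rec {c : ℂ} (hc : c ≠ 0) (Q J : Finset ℂ) (z : ℂ) (hzJ : z ∉ J) (hzQ : z ∉ Q)
    (hQJ : Disjoint Q J) (hcard : Q.card = J.card + 1)
    (hz : ∀ q ∈ Q, hh c q z ≠ 0) (hh' : ∀ q ∈ Q, ∀ k ∈ J, hh c q k ≠ 0) :
    KK c Q (insert z J) = ∑ q ∈ Q, gg c q z * (∏ k ∈ J, ff c q k) *
      (∏ r ∈ Q.erase q, ff c r q) * KK c (Q.erase q) J := by
  classical
  obtain ⟨n, hn⟩ : ∃ n, J.card = n := ⟨_, rfl⟩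
  rw [hn] at hcard
  set v : Fin (n + 1) → ℂ := fun i => ((Q.equivFinOfCardEq hcard).symm i : ℂ) with hvdef
  set u : Fin n → ℂ := fun i => ((J.equivFinOfCardEq hn).symm i : ℂ) with hudef
  have hv : Function.Injective v := Subtype.val_injective.comp (Equiv.injective _)
  have hu : Function.Injective u := Subtype.val_injective.comp (Equiv.injective _)
  have hvQ : ∀ j, v j ∈ Q := fun j => Subtype.prop _
  have huJ : ∀ j, u j ∈ J := fun j => Subtype.prop _
  have hQv : Q = Finset.univ.image v := by
    ext x
    simp only [Finset.mem_image, Finset.mem_univ, true_and]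
    constructor
    · intro hx; exact ⟨Q.equivFinOfCardEq hcard ⟨x, hx⟩, by simp [hvdef]⟩
    · rintro ⟨i, rfl⟩; exact hvQ i
  have hJu : J = Finset.univ.image u := by
    ext x
    simp only [Finset.mem_image, Finset.mem_univ, true_and]
    constructor
    · intro hx; exact ⟨J.equivFinOfCardEq hn ⟨x, hx⟩, by simp [hudef]⟩
    · rintro ⟨i, rfl⟩; exact huJ i
  have hQe : ∀ j, Q.erase (v j) = Finset.univ.image fun i => v (j.succAbove i) := by
    intro j
    ext x
    simp only [Finset.mem_erase, Finset.mem_image, Finset.mem_univ, true_and]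
    constructor
    · rintro ⟨h1, h2⟩
      rw [hQv] at h2
      obtain ⟨i, -, rfl⟩ := Finset.mem_image.1 h2
      obtain ⟨k, rfl⟩ := Fin.exists_succAbove_eq (x := i) (y := j) (fun h => h1 (by rw [h]))
      exact ⟨k, rfl⟩
    · rintro ⟨i, rfl⟩
      exact ⟨fun h => Fin.succAbove_ne j i (hv h), hvQ _⟩
  have hcons : Function.Injective (Fin.cons z u : Fin (n + 1) → ℂ) := by
    rw [Fin.cons_injective_iff]
    exact ⟨by rintro ⟨i, hi⟩; exact hzJ (hi ▸ huJ i), hu⟩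
  have e1 : KK c Q (insert z J) = Kiz c v (Fin.cons z u : Fin (n + 1) → ℂ) := by
    apply KizL_eq c hv hcons (Finset.nodup_toList _) (Finset.nodup_toList _)
    · intro x; simp [hQv]
    · intro x; rw [Fin.range_cons]; simp [hJu]
  have e2 : ∀ j, KK c (Q.erase (v j)) J = Kiz c (fun i => v (j.succAbove i)) u := by
    intro j
    apply KizL_eq c (hv.comp Fin.succAbove_right_injective) hu (Finset.nodup_toList _)
      (Finset.nodup_toList _)
    · intro x; simp [hQe]
    · intro x; simp [hJu]
  rw [e1, Kiz_rec hc v u z hv hu]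
  · conv_rhs => rw [hQv, Finset.sum_image (fun _ _ _ _ h => hv h)]
    rw [← hQv]
    refine Finset.sum_congr rfl fun j _ => ?_
    rw [e2, hQe, Finset.prod_image (fun _ _ _ _ h => Fin.succAbove_right_injective (hv h))]
    congr 3
    conv_rhs => rw [hJu, Finset.prod_image (fun _ _ _ _ h => hu h)]
  · rintro k rfl; exact hzJ (huJ k)
  · rintro k rfl; exact hzQ (hvQ k)
  · intro j k h; exact Finset.disjoint_left.1 hQJ (hvQ j) (h ▸ huJ k)
  · intro j; exact hz _ (hvQ j)
  · intro j k; exact hh' _ (hvQ j) _ (huJ k)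

/-! ### Scalar identities -/

lemma gg_neg (c x y : ℂ) : gg c x y = - gg c y x := by
  unfold gg; rw [← neg_sub, div_neg]

lemma ff_gh {c : ℂ} (hc : c ≠ 0) {x y : ℂ} (h : x ≠ y) : ff c x y = gg c x y * hh c x y := by
  have := sub_ne_zero.2 h
  unfold ff gg hh; field_simp

lemma neg_ff_gh {c : ℂ} (hc : c ≠ 0) {x y : ℂ} (h : x ≠ y) :
    -ff c x y = gg c y x * hh c x y := by
  rw [ff_gh hc h, gg_neg c y x]; ring

lemma three_term {c : ℂ} {w z j : ℂ} (h1 : w ≠ z) (h2 : z ≠ j) (h3 : w ≠ j) :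
    ff c w z * gg c z j + gg c z w * gg c w j = ff c w j * gg c z j := by
  have := sub_ne_zero.2 h1
  have := sub_ne_zero.2 h1.symm
  have := sub_ne_zero.2 h2
  have := sub_ne_zero.2 h3
  unfold ff gg; field_simp; ring

lemma prod_neg_ff {c : ℂ} (hc : c ≠ 0) (z : ℂ) (K : Finset ℂ) (hz : z ∉ K) :
    ∏ k ∈ K, (-ff c z k) = (∏ k ∈ K, gg c k z) * ∏ k ∈ K, hh c z k := by
  rw [← Finset.prod_mul_distrib]
  exact Finset.prod_congr rfl fun k hk => neg_ff_gh hc (by rintro rfl; exact hz hk)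

lemma prod_ff_gh {c : ℂ} (hc : c ≠ 0) (z : ℂ) (K : Finset ℂ) (hz : z ∉ K) :
    ∏ k ∈ K, ff c z k = (∏ k ∈ K, gg c z k) * ∏ k ∈ K, hh c z k := by
  rw [← Finset.prod_mul_distrib]
  exact Finset.prod_congr rfl fun k hk => ff_gh hc (by rintro rfl; exact hz hk)

lemma prod_ff_gh' {c : ℂ} (hc : c ≠ 0) (z : ℂ) (K : Finset ℂ) (hz : z ∉ K) :
    ∏ k ∈ K, ff c k z = (∏ k ∈ K, gg c k z) * ∏ k ∈ K, hh c k z := by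
  rw [← Finset.prod_mul_distrib]
  exact Finset.prod_congr rfl fun k hk => ff_gh hc (by rintro rfl; exact hz hk)

lemma pf2n {c : ℂ} (hc : c ≠ 0) (K : Finset ℂ) (z v : ℂ) (hz : z ∉ K) (hzv : z ≠ v)
    (hv : v ∉ K) :
    gg c z v * ((∏ k ∈ K, gg c k z) * ∏ k ∈ K, hh c z k) +
      ∑ i ∈ K, gg c z i * gg c i v *
        ((∏ k ∈ K.erase i, gg c k i) * ∏ k ∈ K.erase i, hh c i k) =
      gg c z v * ((∏ k ∈ K, gg c k v) * ∏ k ∈ K, hh c v k) := by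
  rw [← prod_neg_ff hc z K hz, ← prod_neg_ff hc v K hv]
  have h := pf2 hc K z v hz hzv hv
  have h1 : ∑ i ∈ K, gg c z i * gg c i v *
        ((∏ k ∈ K.erase i, gg c k i) * ∏ k ∈ K.erase i, hh c i k) =
      (-1) ^ K.card * ∑ i ∈ K, gg c z i*(∏k∈K.erase i, ff c i k)*gg c v i := by
    rw [Finset.mul_sum]
    refine Finset.sum_congr rfl fun i hi => ?_
    rw [← prod_neg_ff hc i _ (Finset.notMem_erase i K), Finset.prod_neg,
      Finset.card_erase_of_mem hi, gg_neg c i v]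
    obtain ⟨n, hn⟩ : ∃ n, K.card = n + 1 :=
      ⟨K.card - 1, by have := Finset.card_pos.2 ⟨i, hi⟩; omega⟩
    rw [hn, pow_succ]; simp; ring
  rw [h1, Finset.prod_neg, Finset.prod_neg, gg_neg c z v]
  linear_combination (-(-1) ^ K.card) * h

/-! ### Moving one operator through a product -/

section moves

variable {c : ℂ} {W : Set ℂ} {B C D E : ℂ → A}

lemma Rel.CC' (R : Rel c W B C D E) {z w : ℂ} (hz : z ∈ W) (hw : w ∈ W) (h : z ≠ w) :
    (-ff c z w) • (C w * C z) = ff c w z • (C z * C w) := by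
  have h1 := R.CC w hw z hz h.symm
  rw [neg_ff_gh R.hc h, ff_gh R.hc h.symm, mul_smul, h1, smul_smul]

lemma Rel.prod_hh_ne (R : Rel c W B C D E) {w : ℂ} {s : Finset ℂ} (hw : w ∈ W) (hs : ↑s ⊆ W)
    (h : w ∉ s) : ∏ y ∈ s, hh c w y ≠ 0 :=
  Finset.prod_ne_zero_iff.2 fun z hz => hh_ne R.hc (R.adm w hw z (hs hz)
        (by rintro rfl; exact h hz))

lemma M1 (R : Rel c W B C D E) (S : Finset ℂ) (z : ℂ) (hz : z ∈ W) (hS : ↑S ⊆ W) (hzS : z ∉ S) :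
    NP c E S * B z = (∏ s ∈ S, ff c s z) • (B z * NP c E S) +
      ∑ i ∈ S, (gg c z i * ∏ s ∈ S.erase i, gg c s i) • (B i * NP c E (S.erase i) * E z) := by
  induction S using Finset.induction_on with
  | empty => simp [NP_empty]
  | insert w S hw ih =>
    simp only [Finset.mem_insert, not_or] at hzS
    have hwW : w ∈ W := hS (by simp)
    have hSW : ↑S ⊆ W := fun y hy => hS (by simp at hy ⊢; right; exact hy)
    have ih := ih hSW hzS.2
    have n0 := R.prod_hh_ne hwW hSW hw
    apply smul_right_injective A n0
    simp only
    rw [← smul_mul_assoc, ← NP_left R.hc R.adm R.EE hw hwW hSW, mul_assoc, ih,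
      Finset.sum_insert hw, Finset.erase_insert hw, Finset.prod_insert hw, mul_add,
      mul_smul_comm, ← mul_assoc, R.EB w hwW z hz (Ne.symm hzS.1), Finset.mul_sum]
    have e1 : ∀ i ∈ S, E w * ((gg c z i * ∏ s ∈ S.erase i, gg c s i) •
        (B i * NP c E (S.erase i) * E z)) =
        (gg c z i * (∏ s ∈ S.erase i, gg c s i) * (gg c w i * ∏ k ∈ S, hh c w k)) •
          (B i * NP c E (insert w (S.erase i)) * E z) +
        ((gg c z i * gg c i w * ((∏ s ∈ S.erase i, gg c s i) * ∏ k ∈ S.erase i, hh c i k)) *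
          ∏ s ∈ S, hh c s z) • (B w * NP c E (insert z S)) := by
      intro i hi
      have hwi : w ≠ i := by rintro rfl; exact hw hi
      have hSe : ↑(S.erase i) ⊆ W := fun y hy => hSW (Finset.erase_subset _ _ hy)
      have a1 : E w * NP c E (S.erase i) =
          (∏ k ∈ S.erase i, hh c w k) • NP c E (insert w (S.erase i)) :=
        NP_left R.hc R.adm R.EE (by simp [hw]) hwW hSe
      have a2 : E i * NP c E (S.erase i) = (∏ k ∈ S.erase i, hh c i k) • NP c E S := by
        have := NP_left R.hc R.adm R.EE (Finset.notMem_erase i S) (hSW hi) hSe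
        rwa [Finset.insert_erase hi] at this
      have a3 := NP_right R.hc R.adm R.EE hzS.2 hz hSW
      rw [mul_smul_comm, ← mul_assoc, ← mul_assoc, R.EB w hwW i (hSW hi) hwi, add_mul,
        smul_mul_assoc, smul_mul_assoc, mul_assoc (B i), mul_assoc (B w), a1, a2, add_mul,
        ← Finset.mul_prod_erase S _ hi, ff_gh R.hc hwi]
      simp only [mul_smul_comm, smul_mul_assoc, smul_add, smul_smul, mul_assoc (B w) _ (E z), a3]
      rw [← Finset.mul_prod_erase S _ hi]
      module
    rw [Finset.sum_congr rfl e1, Finset.sum_add_distrib, ← Finset.sum_smul, ← Finset.sum_mul]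
    have e2 : ∀ i ∈ S, (gg c z i * ∏ s ∈ (insert w S).erase i, gg c s i) •
        (B i * NP c E ((insert w S).erase i) * E z) =
        (gg c z i * (∏ s ∈ S.erase i, gg c s i) * gg c w i) •
          (B i * NP c E (insert w (S.erase i)) * E z) := by
      intro i hi
      have hwi : w ≠ i := by rintro rfl; exact hw hi
      rw [Finset.erase_insert_of_ne hwi, Finset.prod_insert (by simp [hw])]
      module
    have e3 : ∑ i ∈ S, (gg c z i * (∏ s ∈ S.erase i, gg c s i) *
          (gg c w i * ∏ k ∈ S, hh c w k)) • (B i * NP c E (insert w (S.erase i)) * E z) =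
        (∏ k ∈ S, hh c w k) • ∑ i ∈ S, (gg c z i * (∏ s ∈ S.erase i, gg c s i) * gg c w i) •
          (B i * NP c E (insert w (S.erase i)) * E z) := by
      rw [Finset.smul_sum]
      exact Finset.sum_congr rfl fun i _ => by module
    rw [Finset.sum_congr rfl e2, e3]
    have h1 := pf2n R.hc S z w hzS.2 hzS.1 hw
    have a3 := NP_right R.hc R.adm R.EE hzS.2 hz hSW
    have a4 := NP_left R.hc R.adm R.EE hzS.2 hz hSW
    have a5 := NP_left R.hc R.adm R.EE hw hwW hSW
    rw [eq_sub_of_add_eq' h1]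
    simp only [add_mul, smul_mul_assoc, mul_assoc (B _), a3, a4, a5, mul_smul_comm]
    rw [prod_ff_gh' R.hc z S hzS.2]
    module

lemma M2 (R : Rel c W B C D E) (S : Finset ℂ) (z : ℂ) (hz : z ∈ W) (hS : ↑S ⊆ W) (hzS : z ∉ S) :
    B z * CP D S = (∏ s ∈ S, ff c s z) • (CP D S * B z) +
      ∑ i ∈ S, (gg c z i * ∏ s ∈ S.erase i, ff c s i) • (D z * CP D (S.erase i) * B i) := by
  induction S using Finset.induction_on generalizing z with
  | empty => simp [CP_empty]
  | insert w S hw ih =>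
    simp only [Finset.mem_insert, not_or] at hzS
    have hwW : w ∈ W := hS (by simp)
    have hSW : ↑S ⊆ W := fun y hy => hS (by simp at hy ⊢; right; exact hy)
    have ihz := ih z hz hSW hzS.2
    have ihw := ih w hwW hSW hw
    rw [← CP_left R.DD hw hwW hSW, ← mul_assoc, R.BD z hz w hwW hzS.1, add_mul,
      smul_mul_assoc, smul_mul_assoc, mul_assoc, mul_assoc, ihz, ihw,
      Finset.sum_insert hw, Finset.erase_insert hw, Finset.prod_insert hw]
    simp only [mul_add, mul_smul_comm, smul_add, smul_smul, Finset.mul_sum, Finset.smul_sum]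
    have e2 : ∀ i ∈ S, (gg c z i * ∏ s ∈ (insert w S).erase i, ff c s i) •
        (D z * CP D ((insert w S).erase i) * B i) =
        (ff c w z * (gg c z i * ∏ s ∈ S.erase i, ff c s i)) •
          (D w * (D z * CP D (S.erase i) * B i)) +
        (gg c z w * (gg c w i * ∏ s ∈ S.erase i, ff c s i)) •
          (D z * (D w * CP D (S.erase i) * B i)) := by
      intro i hi
      have hwi : w ≠ i := by rintro rfl; exact hw hi
      have hzi : z ≠ i := by rintro rfl; exact hzS.2 hi
      have hSe : ↑(S.erase i) ⊆ W := fun y hy => hSW (Finset.erase_subset _ _ hy)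
      rw [Finset.erase_insert_of_ne hwi, Finset.prod_insert (by simp [hw]),
        ← CP_left R.DD (by simp [hw]) hwW hSe]
      have := R.DD w hwW z hz (Ne.symm hzS.1)
      simp only [← mul_assoc, this]
      rw [← add_smul]
      congr 1
      linear_combination (-∏ s ∈ S.erase i, ff c s i) * three_term (c := c) (Ne.symm hzS.1) hzi hwi
    rw [Finset.sum_congr rfl e2, Finset.sum_add_distrib]
    simp only [mul_assoc]
    module

lemma M4 (R : Rel c W B C D E) (V : Finset ℂ) (z : ℂ) (hz : z ∈ W) (hV : ↑V ⊆ W) (hzV : z ∉ V) :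
    E z * NP c C V = (∏ v ∈ V, (-ff c z v)) • (NP c C V * E z) +
      ∑ j ∈ V, (gg c z j * ∏ k ∈ V.erase j, gg c k j) • (C z * NP c C (V.erase j) * E j) := by
  induction V using Finset.induction_on generalizing z with
  | empty => simp [NP_empty]
  | insert w V hw ih =>
    simp only [Finset.mem_insert, not_or] at hzV
    have hwW : w ∈ W := hV (by simp)
    have hVW : ↑V ⊆ W := fun y hy => hV (by simp at hy ⊢; right; exact hy)
    have ihz := ih z hz hVW hzV.2
    have ihw := ih w hwW hVW hw
    have n0 := R.prod_hh_ne hwW hVW hw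
    apply smul_right_injective A n0
    simp only
    have a5 := NP_left R.hc R.adm R.CC hw hwW hVW
    rw [← mul_smul_comm, ← a5, ← mul_assoc,
      R.EC z hz w hwW hzV.1, add_mul, smul_mul_assoc, smul_mul_assoc, mul_assoc, mul_assoc,
      ihz, ihw, Finset.sum_insert hw, Finset.erase_insert hw, Finset.prod_insert hw]
    simp only [mul_add, mul_smul_comm, smul_add, smul_smul, Finset.mul_sum, Finset.smul_sum]
    have e2 : ∀ i ∈ V, ((∏ y ∈ V, hh c w y) * (gg c z i * ∏ s ∈ (insert w V).erase i, gg c s i)) •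
        (C z * NP c C ((insert w V).erase i) * E i) =
        (-ff c z w * (gg c z i * ∏ s ∈ V.erase i, gg c s i)) •
          (C w * (C z * NP c C (V.erase i) * E i)) +
        (gg c z w * (gg c w i * ∏ s ∈ V.erase i, gg c s i)) •
          (C z * (C w * NP c C (V.erase i) * E i)) := by
      intro i hi
      have hwi : w ≠ i := by rintro rfl; exact hw hi
      have hzi : z ≠ i := by rintro rfl; exact hzV.2 hi
      have hSe : ↑(V.erase i) ⊆ W := fun y hy => hVW (Finset.erase_subset _ _ hy)
      have a1 : C w * NP c C (V.erase i) =
          (∏ k ∈ V.erase i, hh c w k) • NP c C (insert w (V.erase i)) :=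
        NP_left R.hc R.adm R.CC (by simp [hw]) hwW hSe
      have a6 : (-ff c z w * (gg c z i * ∏ s ∈ V.erase i, gg c s i)) •
          (C w * (C z * NP c C (V.erase i) * E i)) =
          (ff c w z * (gg c z i * ∏ s ∈ V.erase i, gg c s i)) •
          (C z * (C w * NP c C (V.erase i) * E i)) := by
        rw [mul_comm (-ff c z w), mul_comm (ff c w z), mul_smul _ (-ff c z w),
          mul_smul _ (ff c w z)]
        congr 1
        simp only [← mul_assoc]
        rw [← smul_mul_assoc, ← smul_mul_assoc, R.CC' hz hwW hzV.1, smul_mul_assoc,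
          smul_mul_assoc]
      rw [a6, a1, Finset.erase_insert_of_ne hwi, Finset.prod_insert (by simp [hw]),
        ← Finset.mul_prod_erase V _ hi]
      simp only [mul_smul_comm, smul_mul_assoc, smul_smul, ← mul_assoc]
      rw [← add_smul]
      congr 1
      have h2 := ff_gh R.hc hwi
      have h3 := three_term (c := c) (Ne.symm hzV.1) hzi hwi
      rw [h2] at h3
      linear_combination (-(∏ s ∈ V.erase i, gg c s i) * ∏ k ∈ V.erase i, hh c w k) * h3
    rw [Finset.sum_congr rfl e2, Finset.sum_add_distrib, prod_neg_ff R.hc w V hw]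
    simp only [← mul_assoc, a5, smul_mul_assoc]
    module

lemma M3 (R : Rel c W B C D E) (V : Finset ℂ) (z : ℂ) (hz : z ∈ W) (hV : ↑V ⊆ W) (hzV : z ∉ V) :
    B z * NP c C V = NP c C V * B z +
      ∑ j ∈ V, (gg c j z * ∏ k ∈ V.erase j, gg c k j) •
        (D j * NP c C (V.erase j) * E z - D z * NP c C (V.erase j) * E j) := by
  induction V using Finset.induction_on with
  | empty => simp [NP_empty]
  | insert w V hw ih =>
    simp only [Finset.mem_insert, not_or] at hzV
    have hwW : w ∈ W := hV (by simp)
    have hVW : ↑V ⊆ W := fun y hy => hV (by simp at hy ⊢; right; exact hy)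
    have ihz := ih hVW hzV.2
    have n0 := R.prod_hh_ne hwW hVW hw
    apply smul_right_injective A n0
    simp only
    have a5 := NP_left R.hc R.adm R.CC hw hwW hVW
    have mz := M4 R V z hz hVW hzV.2
    have mw := M4 R V w hwW hVW hw
    rw [← mul_smul_comm, ← a5, ← mul_assoc,
      R.BC z hz w hwW hzV.1, add_mul, smul_mul_assoc, sub_mul, mul_assoc, mul_assoc, mul_assoc,
      ihz, mz, mw, Finset.sum_insert hw, Finset.erase_insert hw]
    have e2 : ∀ i ∈ V, (∏ y ∈ V, hh c w y) • (gg c i z * ∏ s ∈ (insert w V).erase i, gg c s i) •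
        (D i * NP c C ((insert w V).erase i) * E z - D z * NP c C ((insert w V).erase i) * E i) =
        C w * ((gg c i z * ∏ s ∈ V.erase i, gg c s i) •
          (D i * NP c C (V.erase i) * E z - D z * NP c C (V.erase i) * E i)) +
        gg c w z • (D w * ((gg c z i * ∏ s ∈ V.erase i, gg c s i) •
          (C z * NP c C (V.erase i) * E i))) -
        gg c w z • (D z * ((gg c w i * ∏ s ∈ V.erase i, gg c s i) •
          (C w * NP c C (V.erase i) * E i))) +
        (gg c z i * gg c i w * ((∏ s ∈ V.erase i, gg c s i) * ∏ k ∈ V.erase i, hh c i k)) •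
          (D w * NP c C V * E z) := by
      intro i hi
      have hwi : w ≠ i := by rintro rfl; exact hw hi
      have hzi : z ≠ i := by rintro rfl; exact hzV.2 hi
      have hSe : ↑(V.erase i) ⊆ W := fun y hy => hVW (Finset.erase_subset _ _ hy)
      have a1 : C w * NP c C (V.erase i) =
          (∏ k ∈ V.erase i, hh c w k) • NP c C (insert w (V.erase i)) :=
        NP_left R.hc R.adm R.CC (by simp [hw]) hwW hSe
      have a2 : C i * NP c C (V.erase i) = (∏ k ∈ V.erase i, hh c i k) • NP c C V := by
        have := NP_left R.hc R.adm R.CC (Finset.notMem_erase i V) (hVW hi) hSe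
        rwa [Finset.insert_erase hi] at this
      have b1 : C w * (D i * NP c C (V.erase i) * E z) =
          (ff c w i * ∏ k ∈ V.erase i, hh c w k) •
            (D i * NP c C (insert w (V.erase i)) * E z) +
          (gg c i w * ∏ k ∈ V.erase i, hh c i k) • (D w * NP c C V * E z) := by
        rw [← mul_assoc, ← mul_assoc, R.CD w hwW i (hVW hi) hwi]
        simp only [add_mul, smul_mul_assoc, mul_assoc (D _), a1, a2, mul_smul_comm, smul_smul]
      have b2 : C w * (D z * NP c C (V.erase i) * E i) =
          (ff c w z * ∏ k ∈ V.erase i, hh c w k) •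
            (D z * NP c C (insert w (V.erase i)) * E i) +
          gg c z w • (D w * (C z * NP c C (V.erase i) * E i)) := by
        rw [← mul_assoc, ← mul_assoc, R.CD w hwW z hz (Ne.symm hzV.1)]
        simp only [add_mul, smul_mul_assoc, mul_assoc (D _), a1, mul_smul_comm, smul_smul]
      rw [Finset.erase_insert_of_ne hwi, Finset.prod_insert (by simp [hw]),
        ← Finset.mul_prod_erase V _ hi, mul_smul_comm, mul_sub, b1, b2, a1]
      simp only [mul_smul_comm, smul_mul_assoc, ← mul_assoc]
      have h2 := ff_gh R.hc hwi
      have h3 := three_term (c := c) (Ne.symm hzV.1) hzi hwi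
      rw [h2] at h3 ⊢
      have h4 : gg c w i * hh c w i * gg c i z = ff c w z * gg c i z + gg c w z * gg c w i := by
        rw [gg_neg c i z, gg_neg c w z]
        linear_combination h3
      rw [gg_neg c z w, gg_neg c z i]
      linear_combination (norm := module) (-(∏ k ∈ V.erase i, hh c w k) *
        (∏ s ∈ V.erase i, gg c s i) * h4) • (D z * NP c C (insert w (V.erase i)) * E i)
    have h1 := pf2n R.hc V z w hzV.2 hzV.1 hw
    simp only [mul_add, smul_add, Finset.smul_sum]
    rw [Finset.sum_congr rfl e2]
    simp only [Finset.sum_add_distrib, Finset.sum_sub_distrib]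
    rw [← Finset.sum_smul, eq_sub_of_add_eq' h1, prod_neg_ff R.hc w V hw,
      prod_neg_ff R.hc z V hzV.2, Finset.mul_sum, Finset.mul_sum, Finset.mul_sum]
    simp only [← mul_assoc, a5, smul_mul_assoc, mul_smul_comm, smul_sub, smul_add,
      Finset.smul_sum]
    rw [gg_neg c z w]
    module

end moves

/-! ### The two operators and their recursions -/

/-- `g(X,Y)` -/
def GG (c : ℂ) (X Y : Finset ℂ) : ℂ := ∏ x ∈ X, ∏ y ∈ Y, gg c x y

/-- `f(X,Y)` -/
def FF (c : ℂ) (X Y : Finset ℂ) : ℂ := ∏ x ∈ X, ∏ y ∈ Y, ff c x y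

/-- `h(S,S)` over distinct pairs -/
def HH (c : ℂ) (S : Finset ℂ) : ℂ := ∏ x ∈ S, ∏ y ∈ S.erase x, hh c x y

lemma GG_insert_left (c : ℂ) {x : ℂ} {X : Finset ℂ} (Y : Finset ℂ) (h : x ∉ X) :
    GG c (insert x X) Y = (∏ y ∈ Y, gg c x y) * GG c X Y := Finset.prod_insert h

lemma FF_insert_left (c : ℂ) {x : ℂ} {X : Finset ℂ} (Y : Finset ℂ) (h : x ∉ X) :
    FF c (insert x X) Y = (∏ y ∈ Y, ff c x y) * FF c X Y := Finset.prod_insert h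

lemma GG_insert_right (c : ℂ) {y : ℂ} (X : Finset ℂ) {Y : Finset ℂ} (h : y ∉ Y) :
    GG c X (insert y Y) = (∏ x ∈ X, gg c x y) * GG c X Y := by
  unfold GG
  rw [← Finset.prod_mul_distrib]
  exact Finset.prod_congr rfl fun x _ => Finset.prod_insert h

lemma FF_insert_right (c : ℂ) {y : ℂ} (X : Finset ℂ) {Y : Finset ℂ} (h : y ∉ Y) :
    FF c X (insert y Y) = (∏ x ∈ X, ff c x y) * FF c X Y := by
  unfold FF
  rw [← Finset.prod_mul_distrib]
  exact Finset.prod_congr rfl fun x _ => Finset.prod_insert h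

lemma HH_insert (c : ℂ) {z : ℂ} {J : Finset ℂ} (h : z ∉ J) :
    HH c (insert z J) = HH c J * (∏ j ∈ J, hh c z j) * ∏ j ∈ J, hh c j z := by
  unfold HH
  rw [Finset.prod_insert h, Finset.erase_insert h]
  have : ∏ x ∈ J, ∏ y ∈ (insert z J).erase x, hh c x y =
      ∏ x ∈ J, (hh c x z * ∏ y ∈ J.erase x, hh c x y) := by
    refine Finset.prod_congr rfl fun x hx => ?_
    rw [Finset.erase_insert_of_ne (by rintro rfl; exact h hx), Finset.prod_insert (by simp [h])]
  rw [this, Finset.prod_mul_distrib]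
  ring

/-- coefficient in the recursions -/
def kap (c z : ℂ) (U V : Finset ℂ) (j : ℂ) : ℂ :=
  gg c j z * (∏ x ∈ U, ff c j x) * ∏ k ∈ V.erase j, gg c k j

/-- coefficients of the first operator -/
def coX (c : ℂ) (U V S Q : Finset ℂ) : ℂ :=
  if S.card = Q.card then GG c Q S * FF c S (U \ S) * GG c (V \ Q) Q * HH c S else 0

/-- coefficients of the second operator -/
def coY (c : ℂ) (U V S Q : Finset ℂ) : ℂ :=
  if S.card = Q.card then KK c Q S * FF c S (U \ S) * GG c (V \ Q) Q else 0

/-- the first operator -/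
def Xop (c : ℂ) (B C D E : ℂ → A) (U V : Finset ℂ) : A :=
  ∑ S ∈ U.powerset, ∑ Q ∈ V.powerset, coX c U V S Q •
    (CP D Q * NP c C (V \ Q) * CP B (U \ S) * NP c E S)

/-- the second operator -/
def Yop (c : ℂ) (B C D E : ℂ → A) (U V : Finset ℂ) : A :=
  ∑ S ∈ U.powerset, ∑ Q ∈ V.powerset, coY c U V S Q •
    (CP D S * CP B (U \ S) * NP c C (V \ Q) * NP c E Q)

lemma sum_reorg1 {M : Type*} [AddCommMonoid M] (U : Finset ℂ) (Φ : Finset ℂ → ℂ → M) :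
    ∑ S ∈ U.powerset, ∑ i ∈ S, Φ S i = ∑ J ∈ U.powerset, ∑ i ∈ U \ J, Φ (insert i J) i := by
  rw [Finset.sum_sigma', Finset.sum_sigma']
  refine Finset.sum_bij' (fun p _ => ⟨p.1.erase p.2, p.2⟩) (fun p _ => ⟨insert p.2 p.1, p.2⟩)
    ?_ ?_ ?_ ?_ ?_
  · rintro ⟨S, i⟩ h
    simp only [Finset.mem_sigma, Finset.mem_powerset, Finset.mem_sdiff] at h ⊢
    exact ⟨(Finset.erase_subset _ _).trans h.1, h.1 h.2, Finset.notMem_erase _ _⟩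
  · rintro ⟨S, i⟩ h
    simp only [Finset.mem_sigma, Finset.mem_powerset, Finset.mem_sdiff] at h ⊢
    exact ⟨Finset.insert_subset h.2.1 h.1, Finset.mem_insert_self _ _⟩
  · rintro ⟨S, i⟩ h
    simp only [Finset.mem_sigma, Finset.mem_powerset] at h
    simp only [Finset.insert_erase h.2]
  · rintro ⟨S, i⟩ h
    simp only [Finset.mem_sigma, Finset.mem_powerset, Finset.mem_sdiff] at h
    simp only [Finset.erase_insert h.2.2]
  · rintro ⟨S, i⟩ h
    simp only [Finset.mem_sigma, Finset.mem_powerset] at h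
    simp only [Finset.insert_erase h.2]

lemma sum_reorg2 {M : Type*} [AddCommMonoid M] (V : Finset ℂ) (Ψ : ℂ → Finset ℂ → M) :
    ∑ q ∈ V, ∑ Q' ∈ (V.erase q).powerset, Ψ q Q' =
      ∑ Q ∈ V.powerset, ∑ q ∈ Q, Ψ q (Q.erase q) := by
  rw [Finset.sum_sigma', Finset.sum_sigma']
  refine Finset.sum_bij' (fun p _ => ⟨insert p.1 p.2, p.1⟩) (fun p _ => ⟨p.2, p.1.erase p.2⟩)
    ?_ ?_ ?_ ?_ ?_
  · rintro ⟨i, S⟩ h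
    simp only [Finset.mem_sigma, Finset.mem_powerset, Finset.subset_erase] at h ⊢
    exact ⟨Finset.insert_subset h.1 h.2.1, Finset.mem_insert_self _ _⟩
  · rintro ⟨S, i⟩ h
    simp only [Finset.mem_sigma, Finset.mem_powerset] at h ⊢
    exact ⟨h.1 h.2, Finset.erase_subset_erase _ h.1⟩
  · rintro ⟨i, S⟩ h
    simp only [Finset.mem_sigma, Finset.mem_powerset, Finset.subset_erase] at h
    simp only [Finset.erase_insert h.2.2]
  · rintro ⟨S, i⟩ h
    simp only [Finset.mem_sigma, Finset.mem_powerset] at h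
    simp only [Finset.insert_erase h.2]
  · rintro ⟨i, S⟩ h
    simp only [Finset.mem_sigma, Finset.mem_powerset, Finset.subset_erase] at h
    simp only [Finset.erase_insert h.2.2]

lemma sdiff_erase_erase {V Q : Finset ℂ} {q : ℂ} (hq : q ∈ Q) :
    V.erase q \ Q.erase q = V \ Q := by
  ext x; simp only [Finset.mem_sdiff, Finset.mem_erase]
  constructor
  · rintro ⟨⟨h1, h2⟩, h3⟩; exact ⟨h2, fun h => h3 ⟨h1, h⟩⟩
  · rintro ⟨h1, h2⟩
    exact ⟨⟨by rintro rfl; exact h2 hq, h1⟩, fun h => h2 h.2⟩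

lemma sdiff_insert_insert {U J : Finset ℂ} {z : ℂ} (hz : z ∉ U) :
    insert z U \ insert z J = U \ J := by
  ext x; simp only [Finset.mem_sdiff, Finset.mem_insert, not_or]
  constructor
  · rintro ⟨h1 | h1, h2, h3⟩
    · exact absurd h1 h2
    · exact ⟨h1, h3⟩
  · rintro ⟨h1, h2⟩
    exact ⟨Or.inr h1, by rintro rfl; exact hz h1, h2⟩

lemma prod_V_erase {V Q : Finset ℂ} {q : ℂ} (hQ : Q ⊆ V) (hq : q ∈ Q) (F : ℂ → ℂ) :
    ∏ k ∈ V.erase q, F k = (∏ k ∈ V \ Q, F k) * ∏ k ∈ Q.erase q, F k := by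
  rw [← sdiff_erase_erase hq, Finset.prod_sdiff (Finset.erase_subset_erase _ hQ)]

/-- the common pieces of a coefficient with an index removed from `V` -/
lemma kap_split {c : ℂ} (z : ℂ) {U V J Q : Finset ℂ} (hJ : J ⊆ U) (hQ : Q ⊆ V)
    {q : ℂ} (hq : q ∈ Q) :
    kap c z U V q = gg c q z * ((∏ k ∈ U \ J, ff c q k) * ∏ k ∈ J, ff c q k) *
      ((∏ k ∈ V \ Q, gg c k q) * ∏ k ∈ Q.erase q, gg c k q) := by
  rw [kap, prod_V_erase hQ hq, Finset.prod_sdiff hJ]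

lemma coX_rec {c : ℂ} (hc : c ≠ 0) {U V J Q : Finset ℂ} {z : ℂ} (hJ : J ⊆ U) (hQ : Q ⊆ V)
    (hzU : z ∉ U) (hzV : z ∉ V) (hUV : Disjoint U V) :
    coX c (insert z U) V (insert z J) Q = (∏ j ∈ J, hh c j z) *
      ((∑ i ∈ U \ J, coX c U V (insert i J) Q * (gg c z i * ∏ s ∈ J, gg c s i)) +
        ∑ q ∈ Q, kap c z U V q * coX c U (V.erase q) J (Q.erase q)) := by
  have hzJ : z ∉ J := fun h => hzU (hJ h)
  by_cases hcard : J.card + 1 = Q.card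
  · have e0 : coX c (insert z U) V (insert z J) Q = (∏ j ∈ J, hh c j z) *
        (GG c Q J * FF c J (U \ J) * GG c (V \ Q) Q * HH c J *
        ((∏ k ∈ U \ J, ff c z k) * (∏ j ∈ J, hh c z j) * ∏ q ∈ Q, gg c q z)) := by
      rw [coX, if_pos (by rw [Finset.card_insert_of_notMem hzJ, hcard]),
        sdiff_insert_insert hzU, GG_insert_right c Q hzJ, FF_insert_left c _ hzJ, HH_insert c hzJ]
      ring
    have e1 : ∀ i ∈ U \ J, coX c U V (insert i J) Q * (gg c z i * ∏ s ∈ J, gg c s i) =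
        GG c Q J * FF c J (U \ J) * GG c (V \ Q) Q * HH c J *
        (gg c z i * (∏ k ∈ (U \ J).erase i, ff c i k) * (∏ j ∈ J, hh c i j) *
          ∏ q ∈ Q, gg c q i) := by
      intro i hi
      have hiJ : i ∉ J := (Finset.mem_sdiff.1 hi).2
      rw [coX, if_pos (by rw [Finset.card_insert_of_notMem hiJ, hcard]),
        GG_insert_right c Q hiJ, FF_insert_left c _ hiJ, HH_insert c hiJ, Finset.sdiff_insert]
      conv_rhs => rw [← Finset.insert_erase hi, FF_insert_right c _ (Finset.notMem_erase i _),
        Finset.insert_erase hi, prod_ff_gh' hc i J hiJ]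
      ring
    have e2 : ∀ q ∈ Q, kap c z U V q * coX c U (V.erase q) J (Q.erase q) =
        GG c Q J * FF c J (U \ J) * GG c (V \ Q) Q * HH c J *
        (gg c q z * (∏ k ∈ U \ J, ff c q k) * (∏ j ∈ J, hh c q j) *
          ∏ r ∈ Q.erase q, gg c r q) := by
      intro q hq
      have hqJ : q ∉ J := fun h => Finset.disjoint_left.1 hUV (hJ h) (hQ hq)
      rw [kap_split z hJ hQ hq, coX, if_pos (by rw [Finset.card_erase_of_mem hq]; omega),
        sdiff_erase_erase hq, prod_ff_gh hc q J hqJ]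
      conv_rhs => rw [← Finset.insert_erase hq, GG_insert_left c _ (Finset.notMem_erase q _),
        GG_insert_right c _ (Finset.notMem_erase q _), Finset.insert_erase hq]
      ring
    rw [e0, Finset.sum_congr rfl e1, Finset.sum_congr rfl e2, ← Finset.mul_sum, ← Finset.mul_sum,
      ← mul_add, pf1 hc J (U \ J) Q z (fun h => hzU (Finset.mem_sdiff.1 h).1)
        (fun h => hzV (hQ h)) _ hcard.symm]
    exact Finset.disjoint_of_subset_left Finset.sdiff_subset
      (Finset.disjoint_of_subset_right hQ hUV)
  · rw [coX, if_neg (by rw [Finset.card_insert_of_notMem hzJ]; exact hcard),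
      Finset.sum_eq_zero, Finset.sum_eq_zero]
    · ring
    · intro q hq
      have : 0 < Q.card := Finset.card_pos.2 ⟨q, hq⟩
      rw [coX, if_neg (by rw [Finset.card_erase_of_mem hq]; omega), mul_zero]
    · intro i hi
      rw [coX, if_neg (by rw [Finset.card_insert_of_notMem (Finset.mem_sdiff.1 hi).2]; exact hcard),
        zero_mul]

lemma coY_rec {c : ℂ} (hc : c ≠ 0) {W : Set ℂ}
    (adm : ∀ x ∈ W, ∀ y ∈ W, x ≠ y → x - y + c ≠ 0)
    {U V J Q : Finset ℂ} {z : ℂ} (hJ : J ⊆ U) (hQ : Q ⊆ V)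
    (hz : z ∈ W) (hU : ↑U ⊆ W) (hV : ↑V ⊆ W)
    (hzU : z ∉ U) (hzV : z ∉ V) (hUV : Disjoint U V) :
    coY c (insert z U) V (insert z J) Q =
      ((∑ i ∈ U \ J, coY c U V (insert i J) Q * (gg c z i * ∏ s ∈ J, ff c s i)) +
        ∑ q ∈ Q, kap c z U V q * coY c U (V.erase q) J (Q.erase q) *
          ∏ r ∈ Q.erase q, hh c r q) := by
  have hzJ : z ∉ J := fun h => hzU (hJ h)
  have hQJ : Disjoint Q J :=
    (Finset.disjoint_of_subset_left hJ (Finset.disjoint_of_subset_right hQ hUV)).symm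
  have hne : ∀ q ∈ Q, ∀ x ∈ W, q ≠ x → hh c q x ≠ 0 := fun q hq x hx h =>
    hh_ne hc (adm q (hV (hQ hq)) x hx h)
  by_cases hcard : J.card + 1 = Q.card
  · set a : ℂ → ℂ := fun q => (∏ k ∈ J, ff c q k) * (∏ r ∈ Q.erase q, ff c r q) *
      KK c (Q.erase q) J with ha
    have hK : ∀ x ∈ W, x ∉ J → x ∉ Q → KK c Q (insert x J) = ∑ q ∈ Q, gg c q x * a q := by
      intro x hx hxJ hxQ
      rw [KK_rec hc Q J x hxJ hxQ hQJ hcard.symm]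
      · exact Finset.sum_congr rfl fun q _ => by rw [ha]; ring
      · intro q hq; exact hne q hq x hx (by rintro rfl; exact hxQ hq)
      · intro q hq k hk
        exact hne q hq k (hU (hJ hk)) (by rintro rfl; exact Finset.disjoint_left.1 hQJ hq hk)
    have e0 : coY c (insert z U) V (insert z J) Q = ∑ q ∈ Q,
        (FF c J (U \ J) * GG c (V \ Q) Q * a q) * (gg c q z * ∏ k ∈ U \ J, ff c z k) := by
      rw [coY, if_pos (by rw [Finset.card_insert_of_notMem hzJ, hcard]),
        sdiff_insert_insert hzU, FF_insert_left c _ hzJ, hK z hz hzJ (fun h => hzV (hQ h))]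
      rw [mul_assoc, Finset.sum_mul]
      exact Finset.sum_congr rfl fun q _ => by ring
    have e1 : ∀ i ∈ U \ J, coY c U V (insert i J) Q * (gg c z i * ∏ s ∈ J, ff c s i) =
        ∑ q ∈ Q, (FF c J (U \ J) * GG c (V \ Q) Q * a q) *
        (gg c z i * (∏ k ∈ (U \ J).erase i, ff c i k) * gg c q i) := by
      intro i hi
      have hiU : i ∈ U := (Finset.mem_sdiff.1 hi).1
      have hiJ : i ∉ J := (Finset.mem_sdiff.1 hi).2
      rw [coY, if_pos (by rw [Finset.card_insert_of_notMem hiJ, hcard]),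
        FF_insert_left c _ hiJ, Finset.sdiff_insert, hK i (hU hiU) hiJ
          (fun h => Finset.disjoint_left.1 hUV hiU (hQ h))]
      have : FF c J (U \ J) = (∏ s ∈ J, ff c s i) * FF c J ((U \ J).erase i) := by
        conv_lhs => rw [← Finset.insert_erase hi, FF_insert_right c _ (Finset.notMem_erase i _)]
      rw [this, mul_assoc, mul_assoc, Finset.sum_mul]
      exact Finset.sum_congr rfl fun q _ => by ring
    have e2 : ∀ q ∈ Q, kap c z U V q * coY c U (V.erase q) J (Q.erase q) *
          (∏ r ∈ Q.erase q, hh c r q) =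
        (FF c J (U \ J) * GG c (V \ Q) Q * a q) * (gg c q z * ∏ k ∈ U \ J, ff c q k) := by
      intro q hq
      have hqJ : q ∉ J := fun h => Finset.disjoint_left.1 hUV (hJ h) (hQ hq)
      rw [kap_split z hJ hQ hq, coY, if_pos (by rw [Finset.card_erase_of_mem hq]; omega),
        sdiff_erase_erase hq, ha]
      simp only
      rw [prod_ff_gh' hc q (Q.erase q) (Finset.notMem_erase _ _)]
      have : GG c (V \ Q) Q = (∏ s ∈ V \ Q, gg c s q) * GG c (V \ Q) (Q.erase q) := by
        conv_lhs => rw [← Finset.insert_erase hq, GG_insert_right c _ (Finset.notMem_erase q _),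
          Finset.insert_erase hq]
      rw [this]
      ring
    rw [e0, Finset.sum_congr rfl e1, Finset.sum_congr rfl e2, Finset.sum_comm,
      ← Finset.sum_add_distrib]
    refine Finset.sum_congr rfl fun q hq => ?_
    rw [← Finset.mul_sum, ← mul_add, pf2 hc (U \ J) z q]
    · exact fun h => hzU (Finset.mem_sdiff.1 h).1
    · rintro rfl; exact hzV (hQ hq)
    · exact fun h => Finset.disjoint_left.1 hUV (Finset.mem_sdiff.1 h).1 (hQ hq)
  · rw [coY, if_neg (by rw [Finset.card_insert_of_notMem hzJ]; exact hcard),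
      Finset.sum_eq_zero, Finset.sum_eq_zero]
    · ring
    · intro q hq
      have : 0 < Q.card := Finset.card_pos.2 ⟨q, hq⟩
      rw [coY, if_neg (by rw [Finset.card_erase_of_mem hq]; omega), mul_zero, zero_mul]
    · intro i hi
      rw [coY, if_neg (by rw [Finset.card_insert_of_notMem (Finset.mem_sdiff.1 hi).2]; exact hcard),
        zero_mul]

section recursions

variable {c : ℂ} {W : Set ℂ} {B C D E : ℂ → A}

lemma X_rec (R : Rel c W B C D E) {U V : Finset ℂ} {z : ℂ} (hz : z ∈ W) (hU : ↑U ⊆ W)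
    (hV : ↑V ⊆ W) (hzU : z ∉ U) (hzV : z ∉ V) (hUV : Disjoint U V) :
    Xop c B C D E (insert z U) V = Xop c B C D E U V * B z +
      ∑ j ∈ V, kap c z U V j • (D j * Xop c B C D E U (V.erase j) * E z) := by
  have hsub : ∀ {S T : Finset ℂ}, S ⊆ T → ↑T ⊆ W → ↑S ⊆ W := fun h h' x hx => h' (h hx)
  -- common operator
  set O : Finset ℂ → Finset ℂ → A := fun J Q =>
    CP D Q * NP c C (V \ Q) * CP B (U \ J) * NP c E J * E z with hO
  have t1 : ∀ S ∈ U.powerset, ∑ Q ∈ V.powerset, coX c (insert z U) V S Q •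
      (CP D Q * NP c C (V \ Q) * CP B (insert z U \ S) * NP c E S) =
      (∑ Q ∈ V.powerset, coX c U V S Q •
        (CP D Q * NP c C (V \ Q) * CP B (U \ S) * NP c E S)) * B z -
      ∑ i ∈ S, ∑ Q ∈ V.powerset, (coX c U V S Q * (gg c z i * ∏ s ∈ S.erase i, gg c s i)) •
        O (S.erase i) Q := by
    intro S hS
    rw [Finset.mem_powerset] at hS
    have hzS : z ∉ S := fun h => hzU (hS h)
    rw [Finset.sum_comm, Finset.sum_mul, ← Finset.sum_sub_distrib]
    refine Finset.sum_congr rfl fun Q hQ => ?_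
    have c1 : coX c (insert z U) V S Q = coX c U V S Q * ∏ s ∈ S, ff c s z := by
      unfold coX
      split_ifs
      · rw [Finset.insert_sdiff_of_notMem _ hzS, FF_insert_right c _
          (fun h => hzU (Finset.mem_sdiff.1 h).1)]
        ring
      · simp
    have m1 := M1 R S z hz (hsub hS hU) hzS
    rw [c1, Finset.insert_sdiff_of_notMem _ hzS, ← CP_right R.BB
      (fun h => hzU (Finset.mem_sdiff.1 h).1) hz (hsub Finset.sdiff_subset hU), mul_smul,
      smul_mul_assoc, mul_assoc _ (NP c E S) (B z), m1]
    have m2 : ∀ i ∈ S, (coX c U V S Q * (gg c z i * ∏ s ∈ S.erase i, gg c s i)) • O (S.erase i) Q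
        = coX c U V S Q • (CP D Q * NP c C (V \ Q) * CP B (U \ S) *
          ((gg c z i * ∏ s ∈ S.erase i, gg c s i) • (B i * NP c E (S.erase i) * E z))) := by
      intro i hi
      have : U \ S.erase i = insert i (U \ S) := Finset.sdiff_erase (hS hi)
      rw [hO]
      simp only
      rw [this, ← CP_right R.BB (by simp [hi]) (hU (hS hi)) (hsub Finset.sdiff_subset hU)]
      simp only [mul_smul_comm, mul_assoc, mul_smul]
    rw [Finset.sum_congr rfl m2, ← Finset.smul_sum, ← Finset.mul_sum]
    simp only [mul_add, smul_add, mul_smul_comm, mul_assoc]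
    abel
  have t2 : ∀ J ∈ U.powerset, ∑ Q ∈ V.powerset, coX c (insert z U) V (insert z J) Q •
      (CP D Q * NP c C (V \ Q) * CP B (insert z U \ insert z J) * NP c E (insert z J)) =
      ∑ Q ∈ V.powerset, ((∑ i ∈ U \ J, coX c U V (insert i J) Q *
        (gg c z i * ∏ s ∈ J, gg c s i)) • O J Q +
        (∑ q ∈ Q, kap c z U V q * coX c U (V.erase q) J (Q.erase q)) • O J Q) := by
    intro J hJ
    rw [Finset.mem_powerset] at hJ
    have hzJ : z ∉ J := fun h => hzU (hJ h)
    refine Finset.sum_congr rfl fun Q hQ => ?_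
    rw [Finset.mem_powerset] at hQ
    rw [coX_rec R.hc hJ hQ hzU hzV hUV, ← add_smul, sdiff_insert_insert hzU, mul_comm, mul_smul]
    congr 1
    rw [hO]
    simp only
    rw [mul_assoc _ (NP c E J), NP_right R.hc R.adm R.EE hzJ hz (hsub hJ hU), mul_smul_comm]
  have t3 : ∑ j ∈ V, kap c z U V j • (D j * Xop c B C D E U (V.erase j) * E z) =
      ∑ J ∈ U.powerset, ∑ Q ∈ V.powerset,
        (∑ q ∈ Q, kap c z U V q * coX c U (V.erase q) J (Q.erase q)) • O J Q := by
    have t4 : ∀ j ∈ V, kap c z U V j • (D j * Xop c B C D E U (V.erase j) * E z) =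
        ∑ Q' ∈ (V.erase j).powerset, ∑ J ∈ U.powerset,
          (kap c z U V j * coX c U (V.erase j) J Q') •
          (D j * CP D Q' * NP c C (V.erase j \ Q') * CP B (U \ J) * NP c E J * E z) := by
      intro j hj
      rw [Finset.sum_comm, Xop, Finset.mul_sum, Finset.sum_mul, Finset.smul_sum]
      refine Finset.sum_congr rfl fun J _ => ?_
      rw [Finset.mul_sum, Finset.sum_mul, Finset.smul_sum]
      refine Finset.sum_congr rfl fun Q _ => ?_
      simp only [mul_smul_comm, smul_mul_assoc, mul_assoc, smul_smul]
    rw [Finset.sum_congr rfl t4, sum_reorg2, Finset.sum_comm (s := U.powerset)]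
    refine Finset.sum_congr rfl fun Q hQ => ?_
    rw [Finset.mem_powerset] at hQ
    rw [Finset.sum_comm]
    refine Finset.sum_congr rfl fun J hJ => ?_
    rw [Finset.sum_smul]
    refine Finset.sum_congr rfl fun q hq => ?_
    rw [CP_left R.DD (Finset.notMem_erase q Q) (hV (hQ hq))
      (hsub ((Finset.erase_subset _ _).trans hQ) hV), Finset.insert_erase hq, sdiff_erase_erase hq]
  have t5 : ∑ S ∈ U.powerset, ∑ i ∈ S, ∑ Q ∈ V.powerset,
      (coX c U V S Q * (gg c z i * ∏ s ∈ S.erase i, gg c s i)) • O (S.erase i) Q =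
      ∑ J ∈ U.powerset, ∑ Q ∈ V.powerset, (∑ i ∈ U \ J, coX c U V (insert i J) Q *
        (gg c z i * ∏ s ∈ J, gg c s i)) • O J Q := by
    rw [sum_reorg1]
    refine Finset.sum_congr rfl fun J _ => ?_
    rw [Finset.sum_comm]
    refine Finset.sum_congr rfl fun Q _ => ?_
    rw [Finset.sum_smul]
    refine Finset.sum_congr rfl fun i hi => ?_
    rw [Finset.erase_insert (Finset.mem_sdiff.1 hi).2]
  rw [t3]
  conv_lhs => rw [Xop, Finset.sum_powerset_insert hzU]
  rw [Finset.sum_congr rfl t1, Finset.sum_congr rfl t2, Finset.sum_sub_distrib, t5,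
    ← Finset.sum_mul]
  simp only [Finset.sum_add_distrib]
  rw [← Xop]
  abel

lemma Y_rec (R : Rel c W B C D E) {U V : Finset ℂ} {z : ℂ} (hz : z ∈ W) (hU : ↑U ⊆ W)
    (hV : ↑V ⊆ W) (hzU : z ∉ U) (hzV : z ∉ V) (hUV : Disjoint U V) :
    Yop c B C D E (insert z U) V = B z * Yop c B C D E U V +
      ∑ j ∈ V, kap c z U V j • (D z * Yop c B C D E U (V.erase j) * E j) := by
  have hsub : ∀ {S T : Finset ℂ}, S ⊆ T → ↑T ⊆ W → ↑S ⊆ W := fun h h' x hx => h' (h hx)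
  set O : Finset ℂ → Finset ℂ → A := fun J Q =>
    D z * CP D J * CP B (U \ J) * NP c C (V \ Q) * NP c E Q with hO
  have t1 : ∀ S ∈ U.powerset, ∑ Q ∈ V.powerset, coY c (insert z U) V S Q •
      (CP D S * CP B (insert z U \ S) * NP c C (V \ Q) * NP c E Q) =
      B z * (∑ Q ∈ V.powerset, coY c U V S Q •
        (CP D S * CP B (U \ S) * NP c C (V \ Q) * NP c E Q)) -
      ∑ i ∈ S, ∑ Q ∈ V.powerset, (coY c U V S Q * (gg c z i * ∏ s ∈ S.erase i, ff c s i)) •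
        O (S.erase i) Q := by
    intro S hS
    rw [Finset.mem_powerset] at hS
    have hzS : z ∉ S := fun h => hzU (hS h)
    rw [Finset.sum_comm, Finset.mul_sum, ← Finset.sum_sub_distrib]
    refine Finset.sum_congr rfl fun Q hQ => ?_
    have c1 : coY c (insert z U) V S Q = coY c U V S Q * ∏ s ∈ S, ff c s z := by
      unfold coY
      split_ifs
      · rw [Finset.insert_sdiff_of_notMem _ hzS, FF_insert_right c _
          (fun h => hzU (Finset.mem_sdiff.1 h).1)]
        ring
      · simp
    have m1 := M2 R S z hz (hsub hS hU) hzS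
    rw [c1, Finset.insert_sdiff_of_notMem _ hzS, ← CP_left R.BB
      (fun h => hzU (Finset.mem_sdiff.1 h).1) hz (hsub Finset.sdiff_subset hU), mul_smul,
      mul_smul_comm, ← mul_assoc (B z), ← mul_assoc (B z), ← mul_assoc (B z), m1]
    have m2 : ∀ i ∈ S, (coY c U V S Q * (gg c z i * ∏ s ∈ S.erase i, ff c s i)) • O (S.erase i) Q
        = coY c U V S Q • (((gg c z i * ∏ s ∈ S.erase i, ff c s i) •
          (D z * CP D (S.erase i) * B i)) * (CP B (U \ S) * NP c C (V \ Q) * NP c E Q)) := by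
      intro i hi
      have : U \ S.erase i = insert i (U \ S) := Finset.sdiff_erase (hS hi)
      rw [hO]
      simp only
      rw [this, ← CP_left R.BB (by simp [hi]) (hU (hS hi)) (hsub Finset.sdiff_subset hU)]
      simp only [smul_mul_assoc, mul_assoc, mul_smul]
    rw [Finset.sum_congr rfl m2, ← Finset.smul_sum, ← Finset.sum_mul]
    simp only [add_mul, smul_add, smul_mul_assoc, mul_assoc]
    abel
  have t2 : ∀ J ∈ U.powerset, ∑ Q ∈ V.powerset, coY c (insert z U) V (insert z J) Q •
      (CP D (insert z J) * CP B (insert z U \ insert z J) * NP c C (V \ Q) * NP c E Q) =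
      ∑ Q ∈ V.powerset, ((∑ i ∈ U \ J, coY c U V (insert i J) Q *
        (gg c z i * ∏ s ∈ J, ff c s i)) • O J Q +
        (∑ q ∈ Q, kap c z U V q * coY c U (V.erase q) J (Q.erase q) *
          ∏ r ∈ Q.erase q, hh c r q) • O J Q) := by
    intro J hJ
    rw [Finset.mem_powerset] at hJ
    have hzJ : z ∉ J := fun h => hzU (hJ h)
    refine Finset.sum_congr rfl fun Q hQ => ?_
    rw [Finset.mem_powerset] at hQ
    rw [coY_rec R.hc R.adm hJ hQ hz hU hV hzU hzV hUV, ← add_smul, sdiff_insert_insert hzU]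
    congr 1
    rw [hO]
    simp only
    rw [CP_left R.DD hzJ hz (hsub hJ hU)]
  have t3 : ∑ j ∈ V, kap c z U V j • (D z * Yop c B C D E U (V.erase j) * E j) =
      ∑ J ∈ U.powerset, ∑ Q ∈ V.powerset,
        (∑ q ∈ Q, kap c z U V q * coY c U (V.erase q) J (Q.erase q) *
          ∏ r ∈ Q.erase q, hh c r q) • O J Q := by
    have t4 : ∀ j ∈ V, kap c z U V j • (D z * Yop c B C D E U (V.erase j) * E j) =
        ∑ Q' ∈ (V.erase j).powerset, ∑ J ∈ U.powerset,
          (kap c z U V j * coY c U (V.erase j) J Q') •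
          (D z * CP D J * CP B (U \ J) * NP c C (V.erase j \ Q') * (NP c E Q' * E j)) := by
      intro j hj
      rw [Finset.sum_comm, Yop, Finset.mul_sum, Finset.sum_mul, Finset.smul_sum]
      refine Finset.sum_congr rfl fun J _ => ?_
      rw [Finset.mul_sum, Finset.sum_mul, Finset.smul_sum]
      refine Finset.sum_congr rfl fun Q _ => ?_
      simp only [mul_smul_comm, smul_mul_assoc, mul_assoc, smul_smul]
    rw [Finset.sum_congr rfl t4, sum_reorg2, Finset.sum_comm (s := U.powerset)]
    refine Finset.sum_congr rfl fun Q hQ => ?_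
    rw [Finset.mem_powerset] at hQ
    rw [Finset.sum_comm]
    refine Finset.sum_congr rfl fun J hJ => ?_
    rw [Finset.sum_smul]
    refine Finset.sum_congr rfl fun q hq => ?_
    rw [NP_right R.hc R.adm R.EE (Finset.notMem_erase q Q) (hV (hQ hq))
      (hsub ((Finset.erase_subset _ _).trans hQ) hV), Finset.insert_erase hq, sdiff_erase_erase hq,
      mul_smul_comm, smul_smul]
  have t5 : ∑ S ∈ U.powerset, ∑ i ∈ S, ∑ Q ∈ V.powerset,
      (coY c U V S Q * (gg c z i * ∏ s ∈ S.erase i, ff c s i)) • O (S.erase i) Q =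
      ∑ J ∈ U.powerset, ∑ Q ∈ V.powerset, (∑ i ∈ U \ J, coY c U V (insert i J) Q *
        (gg c z i * ∏ s ∈ J, ff c s i)) • O J Q := by
    rw [sum_reorg1]
    refine Finset.sum_congr rfl fun J _ => ?_
    rw [Finset.sum_comm]
    refine Finset.sum_congr rfl fun Q _ => ?_
    rw [Finset.sum_smul]
    refine Finset.sum_congr rfl fun i hi => ?_
    rw [Finset.erase_insert (Finset.mem_sdiff.1 hi).2]
  rw [t3]
  conv_lhs => rw [Yop, Finset.sum_powerset_insert hzU]
  rw [Finset.sum_congr rfl t1, Finset.sum_congr rfl t2, Finset.sum_sub_distrib, t5,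
    ← Finset.mul_sum]
  simp only [Finset.sum_add_distrib]
  rw [← Yop]
  abel

end recursions

/-! ### Commuting `B` through the first operator -/

lemma sum_symm {M : Type*} [AddCommGroup M] [Module ℂ M] (V : Finset ℂ) (F G : ℂ → ℂ → M)
    (h : ∀ j ∈ V, ∀ k ∈ V, j ≠ k → F j k + F k j = G j k + G k j) :
    ∑ j ∈ V, ∑ k ∈ V.erase j, F j k = ∑ j ∈ V, ∑ k ∈ V.erase j, G j k := by
  have hs : ∀ F : ℂ → ℂ → M, ∑ j ∈ V, ∑ k ∈ V.erase j, F j k =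
      ∑ j ∈ V, ∑ k ∈ V.erase j, F k j := by
    intro F
    apply Finset.sum_comm'
    intro x y
    simp only [Finset.mem_erase]
    constructor
    · rintro ⟨h1, h2, h3⟩; exact ⟨⟨h2.symm, h1⟩, h3⟩
    · rintro ⟨⟨h1, h2⟩, h3⟩; exact ⟨h2, h1.symm, h3⟩
  have h2 : ∀ F : ℂ → ℂ → M, (2 : ℂ) • ∑ j ∈ V, ∑ k ∈ V.erase j, F j k =
      ∑ j ∈ V, ∑ k ∈ V.erase j, (F j k + F k j) := by
    intro F
    simp only [Finset.sum_add_distrib]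
    rw [← hs F, two_smul]
  apply smul_right_injective M (two_ne_zero (α := ℂ))
  simp only
  rw [h2, h2]
  refine Finset.sum_congr rfl fun j hj => Finset.sum_congr rfl fun k hk => ?_
  exact h j hj k (Finset.mem_of_mem_erase hk) (Finset.ne_of_mem_erase hk).symm

lemma id_one {c w z j k : ℂ} (hwz : w ≠ z) (hjw : j ≠ w) (hjz : j ≠ z) (hkw : k ≠ w)
    (hkz : k ≠ z) (h : w - z + c ≠ 0) :
    (gg c j w * ff c j z * gg c k z - gg c k w * ff c k z * gg c j z) *
      ((z - w + c) / (w - z + c)) =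
    ff c j w * gg c j z * gg c k w - ff c k w * gg c k z * gg c j w := by
  have := sub_ne_zero.2 hwz
  have := sub_ne_zero.2 hjw
  have := sub_ne_zero.2 hjz
  have := sub_ne_zero.2 hkw
  have := sub_ne_zero.2 hkz
  unfold gg ff
  field_simp
  ring

lemma id_two {c w z j k : ℂ} (hjk : j ≠ k) (hjw : j ≠ w) (hjz : j ≠ z) (hkw : k ≠ w)
    (hkz : k ≠ z) (h : w - k + c ≠ 0) :
    (-(gg c j w * gg c k j * ff c j z * gg c k z) + gg c k w * gg c j k ^ 2 * gg c z k
      - gg c j w * gg c k j ^ 2 * gg c z j) * ((k - w + c) / (w - k + c)) =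
    - (ff c k w * gg c k z * gg c j k * gg c j w) := by
  have := sub_ne_zero.2 hjk
  have := sub_ne_zero.2 hjw
  have := sub_ne_zero.2 hjz
  have := sub_ne_zero.2 hkw
  have := sub_ne_zero.2 hkz
  rw [gg_neg c k j, gg_neg c z k, gg_neg c z j]
  unfold gg ff
  field_simp
  ring

section wall

variable {c : ℂ} {W : Set ℂ} {B C D E : ℂ → A}

lemma Rel.EE' (R : Rel c W B C D E) {z w : ℂ} (hz : z ∈ W) (hw : w ∈ W) (h : z ≠ w) :
    E z * E w = ((z - w + c) / (w - z + c)) • (E w * E z) := by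
  have h1 := R.EE z hz w hw h
  have n := R.adm w hw z hz h.symm
  have hc := R.hc
  have n2 := hh_ne hc n
  apply smul_right_injective A n2
  simp only
  rw [h1, smul_smul]
  congr 1
  unfold hh
  field_simp

lemma BW (R : Rel c W B C D E) (U V : Finset ℂ) (z : ℂ) (hz : z ∈ W) (hU : ↑U ⊆ W)
    (hV : ↑V ⊆ W) (hzU : z ∉ U) (hzV : z ∉ V) (hUV : Disjoint U V) :
    B z * Xop c B C D E U V = Xop c B C D E U V * B z +
      ∑ j ∈ V, kap c z U V j • (D j * Xop c B C D E U (V.erase j) * E z -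
        D z * Xop c B C D E U (V.erase j) * E j) := by
  induction U using Finset.induction_on generalizing V z with
  | empty =>
    have h : ∀ V, Xop c B C D E ∅ V = NP c C V := by
      intro V
      rw [Xop, Finset.powerset_empty, Finset.sum_singleton, Finset.sum_eq_single ∅]
      · simp [coX, GG, FF, HH, CP_empty, NP_empty]
      · intro Q _ hQ
        rw [coX, if_neg, zero_smul]
        simpa [eq_comm] using hQ
      · simp
    simp only [h, kap, Finset.prod_empty, mul_one]
    exact M3 R V z hz hV hzV
  | insert w U hwU ih =>
    have hwW : w ∈ W := hU (by simp)
    have hUW : ↑U ⊆ W := fun y hy => hU (by simp at hy ⊢; right; exact hy)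
    simp only [Finset.mem_insert, not_or] at hzU
    obtain ⟨hzw, hzU⟩ := hzU
    rw [Finset.disjoint_insert_left] at hUV
    obtain ⟨hwV, hUV⟩ := hUV
    have hVe : ∀ j, ↑(V.erase j) ⊆ W := fun j x hx => hV (Finset.erase_subset _ _ hx)
    have hUVe : ∀ j, Disjoint U (V.erase j) := fun j =>
      Finset.disjoint_of_subset_right (Finset.erase_subset _ _) hUV
    have hne : ∀ {j x}, j ∈ V → x ∉ V → j ≠ x := fun h1 h2 h3 => h2 (h3 ▸ h1)
    set X := Xop c B C D E U with hX
    set L2 : ℂ → ℂ → A := fun j k => kap c w U V j • (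
      ff c j z • (D j * (kap c z U (V.erase j) k • (D k * X ((V.erase j).erase k) * E z -
        D z * X ((V.erase j).erase k) * E k)) * E w) +
      gg c z j • (D z * (kap c j U (V.erase j) k • (D k * X ((V.erase j).erase k) * E j -
        D j * X ((V.erase j).erase k) * E k)) * E w)) with hL2
    set R2 : ℂ → ℂ → A := fun j k => (kap c z U V j * ff c j w) • (
      D j * (kap c w U (V.erase j) k • (D k * X ((V.erase j).erase k) * E w)) * E z -
      D z * (kap c w U (V.erase j) k • (D k * X ((V.erase j).erase k) * E w)) * E j) with hR2
    set S1 : ℂ → A := fun j =>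
      kap c z U V j • (ff c z w • (D j * X (V.erase j) * B w * E z) +
        gg c w z • (D j * X (V.erase j) * B z * E w) -
        ff c j w • (D z * X (V.erase j) * B w * E j) -
        gg c w j • (D z * X (V.erase j) * B j * E w)) +
      kap c w U V j • (ff c j z • (D j * X (V.erase j) * B z * E w) +
        gg c z j • (D z * X (V.erase j) * B j * E w)) with hS1
    have hL : B z * Xop c B C D E (insert w U) V = X V * B w * B z +
        ∑ j ∈ V, S1 j + ∑ j ∈ V, ∑ k ∈ V.erase j, L2 j k := by
      rw [X_rec R hwW hUW hV hwU hwV hUV, mul_add, ← mul_assoc, ih V z hz hUW hV hzU hzV hUV,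
        add_mul, mul_assoc _ (B z) (B w), R.BB z hz w hwW hzw, ← mul_assoc, add_assoc, add_assoc]
      congr 1
      rw [Finset.sum_mul, Finset.mul_sum, ← Finset.sum_add_distrib, ← Finset.sum_add_distrib]
      refine Finset.sum_congr rfl fun j hj => ?_
      have hjW : j ∈ W := hV hj
      have hjw : j ≠ w := hne hj hwV
      have hjz : j ≠ z := hne hj hzV
      have hjU : j ∉ U := fun h => Finset.disjoint_left.1 hUV h hj
      have hzVe : z ∉ V.erase j := fun h => hzV (Finset.mem_of_mem_erase h)
      have b1 : B z * (D j * X (V.erase j) * E w) =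
          ff c j z • (D j * (B z * X (V.erase j)) * E w) +
          gg c z j • (D z * (B j * X (V.erase j)) * E w) := by
        rw [← mul_assoc, ← mul_assoc, R.BD z hz j hjW hjz.symm]
        simp only [add_mul, smul_mul_assoc, mul_assoc]
      have b2 : D j * X (V.erase j) * E z * B w =
          ff c z w • (D j * X (V.erase j) * B w * E z) +
          gg c w z • (D j * X (V.erase j) * B z * E w) := by
        rw [mul_assoc, R.EB z hz w hwW hzw]
        simp only [mul_add, mul_smul_comm, mul_assoc]
      have b3 : D z * X (V.erase j) * E j * B w =
          ff c j w • (D z * X (V.erase j) * B w * E j) +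
          gg c w j • (D z * X (V.erase j) * B j * E w) := by
        rw [mul_assoc, R.EB j hjW w hwW hjw]
        simp only [mul_add, mul_smul_comm, mul_assoc]
      rw [mul_smul_comm, b1, ih (V.erase j) z hz hUW (hVe j) hzU hzVe (hUVe j),
        ih (V.erase j) j hjW hUW (hVe j) hjU (Finset.notMem_erase _ _) (hUVe j),
        smul_mul_assoc, sub_mul, b2, b3, hL2, hS1]
      simp only [mul_add, add_mul, Finset.mul_sum, Finset.sum_mul, smul_add, smul_sub,
        Finset.smul_sum, Finset.sum_add_distrib, mul_assoc]
      abel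
    have hR : Xop c B C D E (insert w U) V * B z +
        ∑ j ∈ V, kap c z (insert w U) V j • (D j * Xop c B C D E (insert w U) (V.erase j) * E z -
          D z * Xop c B C D E (insert w U) (V.erase j) * E j) = X V * B w * B z +
        ∑ j ∈ V, S1 j + ∑ j ∈ V, ∑ k ∈ V.erase j, R2 j k := by
      rw [X_rec R hwW hUW hV hwU hwV hUV, add_mul, add_assoc, add_assoc]
      congr 1
      rw [Finset.sum_mul, ← Finset.sum_add_distrib, ← Finset.sum_add_distrib]
      refine Finset.sum_congr rfl fun j hj => ?_
      have hjW : j ∈ W := hV hj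
      have hjw : j ≠ w := hne hj hwV
      have hjz : j ≠ z := hne hj hzV
      have hwVe : w ∉ V.erase j := fun h => hwV (Finset.mem_of_mem_erase h)
      have hk : kap c z (insert w U) V j = kap c z U V j * ff c j w := by
        rw [kap, kap, Finset.prod_insert hwU]; ring
      have b2 : D j * X (V.erase j) * E w * B z =
          ff c w z • (D j * X (V.erase j) * B z * E w) +
          gg c z w • (D j * X (V.erase j) * B w * E z) := by
        rw [mul_assoc, R.EB w hwW z hz (Ne.symm hzw)]
        simp only [mul_add, mul_smul_comm, mul_assoc]
      rw [hk, X_rec R hwW hUW (hVe j) hwU hwVe (hUVe j), smul_mul_assoc, b2, hR2, hS1]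
      simp only [mul_add, add_mul]
      rw [Finset.mul_sum, Finset.mul_sum, Finset.sum_mul, Finset.sum_mul, ← Finset.smul_sum,
        Finset.sum_sub_distrib]
      simp only [← mul_assoc]
      have k1 : kap c z U V j = gg c j z * ((∏ x ∈ U, ff c j x) * ∏ k ∈ V.erase j, gg c k j) := by
        rw [kap, mul_assoc]
      have k2 : kap c w U V j = gg c j w * ((∏ x ∈ U, ff c j x) * ∏ k ∈ V.erase j, gg c k j) := by
        rw [kap, mul_assoc]
      rw [k1, k2]
      generalize ((∏ x ∈ U, ff c j x) * ∏ k ∈ V.erase j, gg c k j) = P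
      have i1 : gg c j z * ff c z w = gg c j w * gg c z w + gg c j z * ff c j w := by
        have := sub_ne_zero.2 hzw
        have := sub_ne_zero.2 hjw
        have := sub_ne_zero.2 hjz
        unfold gg ff; field_simp; ring
      have i2 : gg c j z * gg c w z + gg c j w * ff c j z = gg c j w * ff c w z := by
        have := sub_ne_zero.2 (Ne.symm hzw)
        have := sub_ne_zero.2 hjw
        have := sub_ne_zero.2 hjz
        unfold gg ff; field_simp; ring
      have i3 : - (gg c j z * gg c w j) + gg c j w * gg c z j = 0 := by
        rw [gg_neg c w j, gg_neg c z j]; ring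
      linear_combination (norm := module) (-P * i1) • (D j * X (V.erase j) * B w * E z) +
        (-P * i2) • (D j * X (V.erase j) * B z * E w) +
        (-P * i3) • (D z * X (V.erase j) * B j * E w)
    rw [hL, hR]
    congr 1
    apply sum_symm
    intro j hj k hk hjk
    have hjW : j ∈ W := hV hj
    have hkW : k ∈ W := hV hk
    have hjw : j ≠ w := hne hj hwV
    have hjz : j ≠ z := hne hj hzV
    have hkw : k ≠ w := hne hk hwV
    have hkz : k ≠ z := hne hk hzV
    have d1 : ∀ Y : A, D k * (D j * Y) = D j * (D k * Y) := fun Y => by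
      rw [← mul_assoc, R.DD k hkW j hjW hjk.symm, mul_assoc]
    have d2 : ∀ Y : A, D j * (D z * Y) = D z * (D j * Y) := fun Y => by
      rw [← mul_assoc, R.DD j hjW z hz hjz, mul_assoc]
    have d3 : ∀ Y : A, D k * (D z * Y) = D z * (D k * Y) := fun Y => by
      rw [← mul_assoc, R.DD k hkW z hz hkz, mul_assoc]
    have q1 := R.EE' hz hwW hzw
    have q2 := R.EE' hjW hwW hjw
    have q3 := R.EE' hkW hwW hkw
    have i1 := id_one (c := c) (Ne.symm hzw) hjw hjz hkw hkz (R.adm w hwW z hz (Ne.symm hzw))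
    have i2 := id_two (c := c) (z := z) hjk hjw hjz hkw hkz (R.adm w hwW k hkW hkw.symm)
    have i3 := id_two (c := c) (z := z) hjk.symm hkw hkz hjw hjz (R.adm w hwW j hjW hjw.symm)
    have hkj : k ∈ V.erase j := Finset.mem_erase.2 ⟨hjk.symm, hk⟩
    have hjk' : j ∈ V.erase k := Finset.mem_erase.2 ⟨hjk, hj⟩
    have kj : ∀ x, kap c x U V j = gg c j x * gg c k j *
        ((∏ x ∈ U, ff c j x) * ∏ l ∈ (V.erase j).erase k, gg c l j) := by
      intro x; rw [kap, ← Finset.mul_prod_erase _ _ hkj]; ring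
    have kk : ∀ x, kap c x U V k = gg c k x * gg c j k *
        ((∏ x ∈ U, ff c k x) * ∏ l ∈ (V.erase j).erase k, gg c l k) := by
      intro x; rw [kap, ← Finset.mul_prod_erase _ _ hjk', Finset.erase_right_comm]; ring
    have kjk : ∀ x, kap c x U (V.erase j) k = gg c k x *
        ((∏ x ∈ U, ff c k x) * ∏ l ∈ (V.erase j).erase k, gg c l k) := by
      intro x; rw [kap]; ring
    have kkj : ∀ x, kap c x U (V.erase k) j = gg c j x *
        ((∏ x ∈ U, ff c j x) * ∏ l ∈ (V.erase j).erase k, gg c l j) := by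
      intro x; rw [kap, Finset.erase_right_comm]; ring
    rw [hL2, hR2]
    simp only [kj, kk, kjk, kkj, Finset.erase_right_comm (a := k) (b := j)]
    generalize ((∏ x ∈ U, ff c j x) * ∏ l ∈ (V.erase j).erase k, gg c l j) = Pj
    generalize ((∏ x ∈ U, ff c k x) * ∏ l ∈ (V.erase j).erase k, gg c l k) = Pk
    generalize X ((V.erase j).erase k) = Y
    simp only [mul_assoc (D _), mul_assoc Y, mul_smul_comm, smul_mul_assoc, mul_sub, sub_mul,
      d1, d2, d3, q1, q2, q3]
    generalize (z - w + c) / (w - z + c) = r1 at *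
    generalize (j - w + c) / (w - j + c) = r2 at *
    generalize (k - w + c) / (w - k + c) = r3 at *
    rw [gg_neg c j k] at *
    linear_combination (norm := module)
      (Pj * Pk * gg c k j * i1) • (D j * (D k * (Y * (E w * E z)))) +
      (Pj * Pk * i2) • (D z * (D j * (Y * (E w * E k)))) +
      (Pj * Pk * i3) • (D z * (D k * (Y * (E w * E j))))

lemma KK_empty (c : ℂ) : KK c ∅ ∅ = 1 := by
  have : KK c ∅ ∅ = Kiz c (Fin.elim0 : Fin 0 → ℂ) (Fin.elim0 : Fin 0 → ℂ) :=
    KizL_eq c (fun i => i.elim0) (fun i => i.elim0) (Finset.nodup_toList _)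
      (Finset.nodup_toList _) (by simp) (by simp)
  rw [this]
  simp [Kiz]

lemma X_eq_Y (R : Rel c W B C D E) (U V : Finset ℂ) (hU : ↑U ⊆ W)
    (hV : ↑V ⊆ W) (hUV : Disjoint U V) : Xop c B C D E U V = Yop c B C D E U V := by
  induction U using Finset.induction_on generalizing V with
  | empty =>
    rw [Xop, Yop]
    simp only [Finset.powerset_empty, Finset.sum_singleton]
    refine Finset.sum_congr rfl fun Q _ => ?_
    rw [coX, coY]
    split_ifs with h
    · have hQ : Q = ∅ := by simpa [eq_comm] using h
      subst hQ
      simp [GG, FF, HH, CP_empty, NP_empty, KK_empty]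
    · simp
  | insert z U hzU ih =>
    have hz : z ∈ W := hU (by simp)
    have hUW : ↑U ⊆ W := fun y hy => hU (by simp at hy ⊢; right; exact hy)
    rw [Finset.disjoint_insert_left] at hUV
    obtain ⟨hzV, hUV⟩ := hUV
    have hVe : ∀ j, ↑(V.erase j) ⊆ W := fun j x hx => hV (Finset.erase_subset _ _ hx)
    have hUVe : ∀ j, Disjoint U (V.erase j) := fun j =>
      Finset.disjoint_of_subset_right (Finset.erase_subset _ _) hUV
    rw [X_rec R hz hUW hV hzU hzV hUV, Y_rec R hz hUW hV hzU hzV hUV, ← ih V hUW hV hUV,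
      BW R U V z hz hUW hV hzU hzV hUV, add_assoc, ← Finset.sum_add_distrib]
    congr 1
    refine Finset.sum_congr rfl fun j _ => ?_
    rw [← ih (V.erase j) hUW (hVe j) (hUVe j), smul_sub, sub_add_cancel]

end wall

/-! ### From lists to finsets -/

lemma sel_nodup {l : List ℂ} (hl : l.Nodup) (S : Finset (Fin l.length)) : (sel l S).Nodup :=
  (Finset.sort_nodup _ _).map (List.nodup_iff_injective_get.1 hl)

lemma sel_toFinset (l : List ℂ) (S : Finset (Fin l.length)) :
    (sel l S).toFinset = S.image l.get := by
  ext x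
  simp [sel]

lemma univ_image_get (l : List ℂ) : (Finset.univ : Finset (Fin l.length)).image l.get
    = l.toFinset := by
  ext x
  simp only [Finset.mem_image, Finset.mem_univ, true_and, List.mem_toFinset]
  rw [List.mem_iff_get]

lemma sel_compl_toFinset {l : List ℂ} (hl : l.Nodup) (S : Finset (Fin l.length)) :
    (sel l Sᶜ).toFinset = l.toFinset \ S.image l.get := by
  rw [sel_toFinset, Finset.compl_eq_univ_sdiff,
    Finset.image_sdiff _ _ (List.nodup_iff_injective_get.1 hl), univ_image_get]

lemma mem_sel {l : List ℂ} {S : Finset (Fin l.length)} {x : ℂ} (h : x ∈ sel l S) : x ∈ l := by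
  simp only [sel, List.mem_map] at h
  obtain ⟨i, _, rfl⟩ := h
  exact List.get_mem _ _

lemma sum_sel {M : Type*} [AddCommMonoid M] {l : List ℂ} (hl : l.Nodup) (φ : Finset ℂ → M) :
    ∑ S : Finset (Fin l.length), φ (S.image l.get) = ∑ S ∈ l.toFinset.powerset, φ S := by
  have hi := List.nodup_iff_injective_get.1 hl
  rw [← univ_image_get, Finset.powerset_image, Finset.powerset_univ,
    Finset.sum_image fun x _ y _ h => Finset.image_injective hi h]

lemma prodGG_eq (c : ℂ) {l l' : List ℂ} (hl : l.Nodup) (hl' : l'.Nodup) :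
    prodGG c l l' = GG c l.toFinset l'.toFinset := by
  simp only [prodGG, GG, List.prod_toFinset _ hl, List.prod_toFinset _ hl']

lemma prodFF_eq (c : ℂ) {l l' : List ℂ} (hl : l.Nodup) (hl' : l'.Nodup) :
    prodFF c l l' = FF c l.toFinset l'.toFinset := by
  simp only [prodFF, FF, List.prod_toFinset _ hl, List.prod_toFinset _ hl']

lemma prodHHne_eq (c : ℂ) {l : List ℂ} (hl : l.Nodup) :
    prodHHne c l = HH c l.toFinset := by
  have hi := List.nodup_iff_injective_get.1 hl
  have key : ∀ φ : ℂ → ℂ, ∏ j : Fin l.length, φ (l.get j) = ∏ x ∈ l.toFinset, φ x := by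
    intro φ
    rw [← univ_image_get, Finset.prod_image fun x _ y _ h => hi h]
  have h2 : ∀ x ∈ l.toFinset, ∏ y ∈ l.toFinset.erase x, hh c x y =
      ∏ y ∈ l.toFinset, if x ≠ y then hh c x y else 1 := by
    intro x hx
    rw [← Finset.mul_prod_erase _ _ hx]
    simp only [ne_eq, not_true_eq_false, if_false, one_mul]
    refine Finset.prod_congr rfl fun y hy => ?_
    rw [if_pos (Finset.ne_of_mem_erase hy).symm]
  rw [HH, Finset.prod_congr rfl h2, ← key, prodHHne]
  refine Finset.prod_congr rfl fun j _ => ?_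
  rw [← key]
  refine Finset.prod_congr rfl fun k _ => ?_
  simp only [ne_eq, hi.eq_iff]

section omega
variable {M : Type*} [AddCommGroup M] [Module ℂ M] [Module Aᵐᵒᵖ M] [IsScalarTower ℂ Aᵐᵒᵖ M]

lemma op_smul_comm (r : ℂ) (a : Aᵐᵒᵖ) (m : M) : a • (r • m) = r • (a • m) := by
  rw [← one_smul Aᵐᵒᵖ m, ← smul_assoc r (1 : Aᵐᵒᵖ) m, smul_smul, smul_smul, ← smul_assoc]
  simp

lemma omega_Tprod (D : ℂ → A) (lam : ℂ → ℂ) (w : M) (h : ∀ z, op (D z) • w = lam z • w)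
    (l : List ℂ) (x : A) :
    op (Tprod D l * x) • w = lamP lam l • (op x • w) := by
  have : ∀ l : List ℂ, op (Tprod D l) • w = lamP lam l • w := by
    intro l
    induction l with
    | nil => simp [Tprod, lamP]
    | cons z l ih =>
      have e1 : Tprod D (z :: l) = D z * Tprod D l := by simp [Tprod]
      have e2 : lamP lam (z :: l) = lam z * lamP lam l := by simp [lamP]
      rw [e1, e2, op_mul, mul_smul, h, op_smul_comm, ih, smul_smul]
  rw [op_mul, mul_smul, this, op_smul_comm]

lemma PsiA_eq {c : ℂ} {W : Set ℂ} {T : Fin 3 → Fin 3 → ℂ → A}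
    (R : Rel c W (T 1 0) (T 2 1) (T 1 1) (T 2 0)) (lam : ℂ → ℂ) (w : M)
    (h : ∀ z, op (T 1 1 z) • w = lam z • w) {u v : List ℂ} (hu : u.Nodup) (hv : v.Nodup)
    (huW : ∀ x ∈ u, x ∈ W) (hvW : ∀ x ∈ v, x ∈ W) :
    PsiA c T lam u v w =
      op (Xop c (T 1 0) (T 2 1) (T 1 1) (T 2 0) u.toFinset v.toFinset) • w := by
  rw [Xop, ← sum_sel hu, PsiA, Finset.op_sum, Finset.sum_smul]
  refine Finset.sum_congr rfl fun S _ => ?_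
  rw [← sum_sel hv, Finset.op_sum, Finset.sum_smul]
  refine Finset.sum_congr rfl fun Q _ => ?_
  have iu := List.nodup_iff_injective_get.1 hu
  have iv := List.nodup_iff_injective_get.1 hv
  rw [coX, Finset.card_image_of_injective _ iu, Finset.card_image_of_injective _ iv]
  split_ifs with hc
  · rw [← sel_compl_toFinset hu, ← sel_compl_toFinset hv, ← sel_toFinset, ← sel_toFinset,
      ← prodGG_eq c (sel_nodup hv _) (sel_nodup hu _),
      ← prodGG_eq c (sel_nodup hv _) (sel_nodup hv _),
      ← prodFF_eq c (sel_nodup hu _) (sel_nodup hu _),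
      ← prodHHne_eq c (sel_nodup hu _),
      ← CP_eq R.DD (sel_nodup hv _) fun x hx => hvW x (mem_sel hx),
      ← CP_eq R.BB (sel_nodup hu _) fun x hx => huW x (mem_sel hx),
      ← NP_eq R.hc R.adm R.CC (sel_nodup hv _) fun x hx => hvW x (mem_sel hx),
      ← NP_eq R.hc R.adm R.EE (sel_nodup hu _) fun x hx => huW x (mem_sel hx),
      op_smul, smul_assoc, mul_assoc (Tprod (T 1 1) _), mul_assoc (Tprod (T 1 1) _),
      omega_Tprod _ _ _ h, smul_smul]
  · simp

lemma PsiB_eq {c : ℂ} {W : Set ℂ} {T : Fin 3 → Fin 3 → ℂ → A}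
    (R : Rel c W (T 1 0) (T 2 1) (T 1 1) (T 2 0)) (lam : ℂ → ℂ) (w : M)
    (h : ∀ z, op (T 1 1 z) • w = lam z • w) {u v : List ℂ} (hu : u.Nodup) (hv : v.Nodup)
    (huW : ∀ x ∈ u, x ∈ W) (hvW : ∀ x ∈ v, x ∈ W) :
    PsiB c T lam u v w =
      op (Yop c (T 1 0) (T 2 1) (T 1 1) (T 2 0) u.toFinset v.toFinset) • w := by
  rw [Yop, ← sum_sel hu, PsiB, Finset.op_sum, Finset.sum_smul]
  refine Finset.sum_congr rfl fun S _ => ?_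
  rw [← sum_sel hv, Finset.op_sum, Finset.sum_smul]
  refine Finset.sum_congr rfl fun Q _ => ?_
  have iu := List.nodup_iff_injective_get.1 hu
  have iv := List.nodup_iff_injective_get.1 hv
  rw [coY, Finset.card_image_of_injective _ iu, Finset.card_image_of_injective _ iv]
  split_ifs with hc
  · rw [← sel_compl_toFinset hu, ← sel_compl_toFinset hv, ← sel_toFinset, ← sel_toFinset,
      ← KizL_eq_KK c (sel_nodup hv _) (sel_nodup hu _),
      ← prodGG_eq c (sel_nodup hv _) (sel_nodup hv _),
      ← prodFF_eq c (sel_nodup hu _) (sel_nodup hu _),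
      ← CP_eq R.DD (sel_nodup hu _) fun x hx => huW x (mem_sel hx),
      ← CP_eq R.BB (sel_nodup hu _) fun x hx => huW x (mem_sel hx),
      ← NP_eq R.hc R.adm R.CC (sel_nodup hv _) fun x hx => hvW x (mem_sel hx),
      ← NP_eq R.hc R.adm R.EE (sel_nodup hv _) fun x hx => hvW x (mem_sel hx),
      op_smul, smul_assoc, mul_assoc (Tprod (T 1 1) _), mul_assoc (Tprod (T 1 1) _),
      omega_Tprod _ _ _ h, smul_smul]
  · simp

end omega

/-- the two explicit expressions for the dual `Y(2|1)` Bethe vector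
agree. -/
theorem statement14 {E : Type*} [AddCommGroup E] [Module ℂ E] [Module Aᵐᵒᵖ E]
    [IsScalarTower ℂ Aᵐᵒᵖ E]
    (c : ℂ) (hc : c ≠ 0) (T : Fin 3 → Fin 3 → ℂ → A)
    (hT : IsTFam c p21 T) (lam : Fin 3 → ℂ → ℂ) (Ωd : E)
    (hlw0 : ∀ i j : Fin 3, i < j → ∀ z : ℂ, op (T i j z) • Ωd = 0)
    (hlw1 : ∀ i : Fin 3, ∀ z : ℂ, op (T i i z) • Ωd = lam i z • Ωd)
    (u v : List ℂ) (hadm : Admissible c (u ++ v)) :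
    PsiA c T (lam 1) u v Ωd = PsiB c T (lam 1) u v Ωd := by
  have hnd : (u ++ v).Nodup := hadm.imp fun h => h.1
  have adm : ∀ x ∈ {x | x ∈ u ++ v}, ∀ y ∈ {x | x ∈ u ++ v}, x ≠ y → x - y + c ≠ 0 := by
    intro x hx y hy hxy
    have h2 : (u ++ v).Pairwise fun x y => x - y + c ≠ 0 ∧ y - x + c ≠ 0 :=
      List.Pairwise.imp (fun h => h.2) hadm
    have : Std.Symm fun x y : ℂ => x - y + c ≠ 0 ∧ y - x + c ≠ 0 := ⟨fun _ _ h => And.symm h⟩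
    exact (h2.forall hx hy hxy).1
  have R := rel_of_fam c hc T hT {x | x ∈ u ++ v} adm
  obtain ⟨hu, hv, hd⟩ := List.nodup_append'.1 hnd
  have huW : ∀ x ∈ u, x ∈ {x | x ∈ u ++ v} := fun x hx => List.mem_append_left _ hx
  have hvW : ∀ x ∈ v, x ∈ {x | x ∈ u ++ v} := fun x hx => List.mem_append_right _ hx
  rw [PsiA_eq R (lam 1) Ωd (hlw1 1) hu hv huW hvW, PsiB_eq R (lam 1) Ωd (hlw1 1) hu hv huW hvW,
    X_eq_Y R u.toFinset v.toFinset (fun x hx => huW x (by simpa using hx))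
      (fun x hx => hvW x (by simpa using hx)) (List.disjoint_toFinset_iff_disjoint.2 hd)]

end Bethe
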